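/- (Regularity criterion for the Navier–Stokes equations.) Let N > 2 and p > N. Let (v,q) be a classical Schwartz solution on ℝ^N × [0,T) (with 0 < T ≤ ∞) of the Navier–Stokes equations v_t + (v·∇)v = −∇q + Δv, div v = 0, and suppose v is uniformly bounded in L^p: sup_{0 ≤ t < T} (∫_{ℝ^N} |v(x,t)|^p dx)^{1/p} < ∞. Then v does not blow up and is uniformly bounded: sup_{(x,t) ∈ ℝ^N × [0,T)} |v(x,t)| < ∞. -/

import Mathlib

open MeasureTheory Set
open scoped ENNReal

/-- Partial derivative `∂f/∂x_i` of `f : ℝ^N → ℝ` at `x`. -/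
noncomputable def pd {N : ℕ} (i : Fin N) (f : (Fin N → ℝ) → ℝ) (x : Fin N → ℝ) : ℝ :=
  fderiv ℝ f x (Pi.single i 1)

/-- `f : ℝ^N → ℝ` belongs to the Schwartz class of rapidly decreasing smooth functions. -/
def IsSchwartz {N : ℕ} (f : (Fin N → ℝ) → ℝ) : Prop :=
  ∃ g : SchwartzMap (Fin N → ℝ) ℝ, ∀ x, g x = f x

namespace NavierStokes

open Filter Topology
open scoped SchwartzMap

variable {N : ℕ}

/-! ### The heat kernel and its derivatives -/

/-- The heat kernel on `ℝ^N`. -/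
noncomputable def heat (s : ℝ) (z : Fin N → ℝ) : ℝ :=
  (4 * Real.pi * s) ^ (-(N : ℝ) / 2) * Real.exp (-(∑ i, z i ^ 2) / (4 * s))

/-- First partial derivatives of the heat kernel. -/
noncomputable def heat₁ (j : Fin N) (s : ℝ) (z : Fin N → ℝ) : ℝ :=
  -(z j / (2 * s)) * heat s z

/-- Second partial derivatives of the heat kernel. -/
noncomputable def heat₂ (j k : Fin N) (s : ℝ) (z : Fin N → ℝ) : ℝ :=
  (z j * z k / (4 * s ^ 2) - (Pi.single k 1 : Fin N → ℝ) j / (2 * s)) * heat s z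

/-- Third partial derivatives of the heat kernel. -/
noncomputable def heat₃ (j k l : Fin N) (s : ℝ) (z : Fin N → ℝ) : ℝ :=
  (-(z j * z k * z l / (8 * s ^ 3)) +
    ((Pi.single l 1 : Fin N → ℝ) j * z k + (Pi.single l 1 : Fin N → ℝ) k * z j +
      (Pi.single k 1 : Fin N → ℝ) j * z l) / (4 * s ^ 2)) * heat s z

lemma heat_pos {s : ℝ} (hs : 0 < s) (z : Fin N → ℝ) : 0 < heat s z := by
  unfold heat; positivity

@[fun_prop]
lemma continuous_heat (s : ℝ) : Continuous (heat s : (Fin N → ℝ) → ℝ) := by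
  unfold heat; fun_prop

@[fun_prop]
lemma continuous_heat₁ (j : Fin N) (s : ℝ) : Continuous (heat₁ j s) := by
  unfold heat₁; fun_prop

@[fun_prop]
lemma continuous_heat₂ (j k : Fin N) (s : ℝ) : Continuous (heat₂ j k s) := by
  unfold heat₂; fun_prop

@[fun_prop]
lemma continuous_heat₃ (j k l : Fin N) (s : ℝ) : Continuous (heat₃ j k l s) := by
  unfold heat₃; fun_prop

lemma heat_eq_prod {s : ℝ} (hs : 0 < s) (z : Fin N → ℝ) :
    heat s z = ∏ i, (Real.sqrt (4 * Real.pi * s))⁻¹ * Real.exp (-(1 / (4 * s)) * z i ^ 2) := by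
  rw [Finset.prod_mul_distrib, ← Real.exp_sum, ← Finset.mul_sum, heat]
  congr 1
  · rw [Finset.prod_const, Finset.card_univ, Fintype.card_fin, Real.sqrt_eq_rpow,
      ← Real.rpow_neg (by positivity), ← Real.rpow_natCast, ← Real.rpow_mul (by positivity)]
    congr 1; ring
  · congr 1; ring

lemma integrable_heat {s : ℝ} (hs : 0 < s) : Integrable (heat s : (Fin N → ℝ) → ℝ) := by
  have h : (heat s : (Fin N → ℝ) → ℝ) = fun z => ∏ i,
      (fun y => (Real.sqrt (4 * Real.pi * s))⁻¹ * Real.exp (-(1 / (4 * s)) * y ^ 2)) (z i) := by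
    funext z; exact heat_eq_prod hs z
  rw [h]
  refine Integrable.fintype_prod (f := fun (_ : Fin N) (y : ℝ) =>
    (Real.sqrt (4 * Real.pi * s))⁻¹ * Real.exp (-(1 / (4 * s)) * y ^ 2)) fun i => ?_
  exact (integrable_exp_neg_mul_sq (by positivity)).const_mul _

lemma integral_heat {s : ℝ} (hs : 0 < s) : ∫ z : Fin N → ℝ, heat s z = 1 := by
  have h : (heat s : (Fin N → ℝ) → ℝ) = fun z => ∏ i,
      (fun y => (Real.sqrt (4 * Real.pi * s))⁻¹ * Real.exp (-(1 / (4 * s)) * y ^ 2)) (z i) := by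
    funext z; exact heat_eq_prod hs z
  rw [h, integral_fintype_prod_volume_eq_prod (fun (_ : Fin N) (y : ℝ) =>
    (Real.sqrt (4 * Real.pi * s))⁻¹ * Real.exp (-(1 / (4 * s)) * y ^ 2))]
  refine Finset.prod_eq_one fun i _ => ?_
  rw [integral_const_mul, integral_gaussian]
  rw [show Real.pi / (1 / (4 * s)) = 4 * Real.pi * s by field_simp]
  exact inv_mul_cancel₀ (by positivity)

lemma heat_le_sup {s : ℝ} (hs : 0 < s) (z : Fin N → ℝ) :
    heat s z ≤ s ^ (-(N : ℝ) / 2) := by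
  have h1 : Real.exp (-(∑ i, z i ^ 2) / (4 * s)) ≤ 1 := by
    rw [Real.exp_le_one_iff, neg_div]
    have : 0 ≤ (∑ i, z i ^ 2) / (4 * s) :=
      div_nonneg (Finset.sum_nonneg fun i _ => sq_nonneg _) (by positivity)
    linarith
  have h2 : (4 * Real.pi * s) ^ (-(N : ℝ) / 2) ≤ s ^ (-(N : ℝ) / 2) := by
    apply Real.rpow_le_rpow_of_nonpos hs
    · nlinarith [Real.pi_gt_three]
    · have : (0 : ℝ) ≤ N := Nat.cast_nonneg N
      linarith
  calc heat s z ≤ (4 * Real.pi * s) ^ (-(N : ℝ) / 2) * 1 := by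
        unfold heat; gcongr
    _ ≤ _ := by simpa using h2

lemma heat_le_heat {s s' : ℝ} (hs : 0 < s) (h : s ≤ s') (z : Fin N → ℝ) :
    heat s z ≤ (s' / s) ^ ((N : ℝ) / 2) * heat s' z := by
  have hs' : 0 < s' := hs.trans_le h
  have h1 : (4 * Real.pi * s) ^ (-(N : ℝ) / 2) =
      (s' / s) ^ ((N : ℝ) / 2) * (4 * Real.pi * s') ^ (-(N : ℝ) / 2) := by
    rw [neg_div, Real.rpow_neg (by positivity), Real.rpow_neg (by positivity),
      Real.div_rpow hs'.le hs.le, Real.mul_rpow (by positivity) hs.le,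
      Real.mul_rpow (by positivity) hs'.le]
    field_simp
  unfold heat
  rw [h1, mul_assoc, neg_div (4 * s), neg_div (4 * s')]
  have : 0 ≤ ∑ i, z i ^ 2 := Finset.sum_nonneg fun i _ => sq_nonneg _
  gcongr

/-- The constant in the pointwise bounds of the derivatives of the heat kernel. -/
noncomputable def heatC (N : ℕ) : ℝ := 100 * 2 ^ ((N : ℝ) / 2)

lemma heatC_pos (N : ℕ) : 0 < heatC N := by unfold heatC; positivity

lemma heat_eq_double {s : ℝ} (hs : 0 < s) (z : Fin N → ℝ) :
    heat s z = 2 ^ ((N : ℝ) / 2) * heat (2 * s) z * Real.exp (-((∑ i, z i ^ 2) / (8 * s))) := by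
  unfold heat
  rw [mul_assoc (_ ^ _), mul_assoc (_ ^ _), ← Real.exp_add, ← mul_assoc]
  congr 1
  · rw [neg_div, Real.rpow_neg (by positivity), Real.rpow_neg (by positivity),
      show 4 * Real.pi * (2 * s) = 2 * (4 * Real.pi * s) by ring,
      Real.mul_rpow (x := 2) (by positivity) (by positivity)]
    field_simp
  · congr 1; field_simp; ring

lemma abs_mul_heat_le {s : ℝ} (hs : 0 < s) (z : Fin N → ℝ) {P A : ℝ}
    (hP : |P| ≤ A * (100 * Real.exp ((∑ i, z i ^ 2) / (8 * s)))) :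
    |P * heat s z| ≤ heatC N * A * heat (2 * s) z := by
  rw [abs_mul, abs_of_pos (heat_pos hs z), heat_eq_double hs z]
  have h2 := heat_pos (N := N) (s := 2 * s) (by positivity) z
  set X := (∑ i, z i ^ 2) / (8 * s)
  calc |P| * (2 ^ ((N : ℝ) / 2) * heat (2 * s) z * Real.exp (-X))
      ≤ A * (100 * Real.exp X) * (2 ^ ((N : ℝ) / 2) * heat (2 * s) z * Real.exp (-X)) := by
        gcongr
    _ = heatC N * A * heat (2 * s) z := by
        rw [Real.exp_neg, heatC]; field_simp

lemma abs_single_le_one (k j : Fin N) : |(Pi.single k 1 : Fin N → ℝ) j| ≤ 1 := by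
  by_cases h : j = k
  · subst h; simp
  · simp [h]

lemma sq_coord_le {s : ℝ} (hs : 0 < s) (z : Fin N → ℝ) (j : Fin N) :
    (z j / Real.sqrt s) ^ 2 ≤ 8 * ((∑ i, z i ^ 2) / (8 * s)) := by
  rw [div_pow, Real.sq_sqrt hs.le]
  have : z j ^ 2 ≤ ∑ i, z i ^ 2 :=
    Finset.single_le_sum (f := fun i => z i ^ 2) (fun i _ => sq_nonneg _) (Finset.mem_univ j)
  calc z j ^ 2 / s ≤ (∑ i, z i ^ 2) / s := by gcongr
    _ = _ := by field_simp

lemma abs_heat₁_le {s : ℝ} (hs : 0 < s) (z : Fin N → ℝ) (j : Fin N) :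
    |heat₁ j s z| ≤ heatC N * s ^ (-(1 / 2) : ℝ) * heat (2 * s) z := by
  unfold heat₁
  refine abs_mul_heat_le hs z ?_
  have hw := sq_coord_le hs z j
  set X := (∑ i, z i ^ 2) / (8 * s)
  have hX : 1 + X ≤ Real.exp X := by linarith [Real.add_one_le_exp X]
  have hr : s ^ (-(1 / 2) : ℝ) = (Real.sqrt s)⁻¹ := by
    rw [Real.rpow_neg hs.le, Real.sqrt_eq_rpow]
  have hq := Real.sqrt_pos.2 hs
  have e : -(z j / (2 * s)) = (Real.sqrt s)⁻¹ * (-(z j / Real.sqrt s) / 2) := by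
    have : s = Real.sqrt s * Real.sqrt s := (Real.mul_self_sqrt hs.le).symm
    nth_rewrite 1 [this]; field_simp
  rw [e, hr, abs_mul, abs_of_pos (inv_pos.2 hq)]
  gcongr
  set w := z j / Real.sqrt s
  rw [abs_le]
  constructor <;> nlinarith [sq_nonneg (w - 1), sq_nonneg (w + 1)]

lemma abs_heat₂_le {s : ℝ} (hs : 0 < s) (z : Fin N → ℝ) (j k : Fin N) :
    |heat₂ j k s z| ≤ heatC N * s ^ (-1 : ℝ) * heat (2 * s) z := by
  unfold heat₂
  refine abs_mul_heat_le hs z ?_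
  have hj := sq_coord_le hs z j
  have hk := sq_coord_le hs z k
  have hd := abs_le.1 (abs_single_le_one k j)
  set d := (Pi.single k 1 : Fin N → ℝ) j
  set X := (∑ i, z i ^ 2) / (8 * s)
  have hX : 1 + X ≤ Real.exp X := by linarith [Real.add_one_le_exp X]
  have hq := Real.sqrt_pos.2 hs
  have hss : s = Real.sqrt s * Real.sqrt s := (Real.mul_self_sqrt hs.le).symm
  have e : z j * z k / (4 * s ^ 2) - d / (2 * s) =
      s⁻¹ * ((z j / Real.sqrt s) * (z k / Real.sqrt s) / 4 - d / 2) := by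
    rw [div_mul_div_comm, ← hss]; field_simp
  rw [e, Real.rpow_neg_one, abs_mul, abs_of_pos (inv_pos.2 hs)]
  gcongr
  set a := z j / Real.sqrt s
  set b := z k / Real.sqrt s
  rw [abs_le]
  constructor <;> nlinarith [sq_nonneg (a - b), sq_nonneg (a + b)]

lemma abs_heat₃_le {s : ℝ} (hs : 0 < s) (z : Fin N → ℝ) (j k l : Fin N) :
    |heat₃ j k l s z| ≤ heatC N * s ^ (-(3 / 2) : ℝ) * heat (2 * s) z := by
  unfold heat₃
  refine abs_mul_heat_le hs z ?_
  have hj := sq_coord_le hs z j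
  have hk := sq_coord_le hs z k
  have hl := sq_coord_le hs z l
  have hd1 := abs_single_le_one l j
  have hd2 := abs_single_le_one l k
  have hd3 := abs_single_le_one k j
  generalize (Pi.single l 1 : Fin N → ℝ) j = d1 at *
  generalize (Pi.single l 1 : Fin N → ℝ) k = d2 at *
  generalize (Pi.single k 1 : Fin N → ℝ) j = d3 at *
  have hX0 : 0 ≤ (∑ i, z i ^ 2) / (8 * s) :=
    div_nonneg (Finset.sum_nonneg fun i _ => sq_nonneg _) (by positivity)
  generalize (∑ i, z i ^ 2) / (8 * s) = X at *
  have hX : 1 + X + X ^ 2 / 2 ≤ Real.exp X := Real.quadratic_le_exp_of_nonneg hX0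
  have hq := Real.sqrt_pos.2 hs
  have hss : Real.sqrt s ^ 2 = s := Real.sq_sqrt hs.le
  have hr : s ^ (-(3 / 2) : ℝ) = s⁻¹ * (Real.sqrt s)⁻¹ := by
    rw [Real.sqrt_eq_rpow, ← Real.rpow_neg_one, ← Real.rpow_neg hs.le, ← Real.rpow_add hs]
    norm_num
  have e : -(z j * z k * z l / (8 * s ^ 3)) + (d1 * z k + d2 * z j + d3 * z l) / (4 * s ^ 2) =
      (s⁻¹ * (Real.sqrt s)⁻¹) * (-((z j / Real.sqrt s) * (z k / Real.sqrt s) *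
        (z l / Real.sqrt s) / 8) + (d1 * (z k / Real.sqrt s) + d2 * (z j / Real.sqrt s)
          + d3 * (z l / Real.sqrt s)) / 4) := by
    set q := Real.sqrt s
    rw [← hss]; field_simp
  rw [e, hr, abs_mul, abs_of_pos (mul_pos (inv_pos.2 hs) (inv_pos.2 hq))]
  gcongr
  generalize z j / Real.sqrt s = a at *
  generalize z k / Real.sqrt s = b at *
  generalize z l / Real.sqrt s = c at *
  have ha : |a| ≤ 1 / 2 + 4 * X := by
    rw [abs_le]; constructor <;> nlinarith [sq_nonneg (a - 1), sq_nonneg (a + 1)]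
  have hb : |b| ≤ 1 / 2 + 4 * X := by
    rw [abs_le]; constructor <;> nlinarith [sq_nonneg (b - 1), sq_nonneg (b + 1)]
  have hc : |c| ≤ 1 / 2 + 4 * X := by
    rw [abs_le]; constructor <;> nlinarith [sq_nonneg (c - 1), sq_nonneg (c + 1)]
  have hab : |a * b| ≤ 8 * X := by
    rw [abs_le]; constructor <;> nlinarith [sq_nonneg (a - b), sq_nonneg (a + b)]
  have h3 : |a * b * c| ≤ 8 * X * (1 / 2 + 4 * X) := by
    rw [abs_mul]; gcongr
  have h4 : |d1 * b| ≤ 1 * (1 / 2 + 4 * X) := by rw [abs_mul]; gcongr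
  have h5 : |d2 * a| ≤ 1 * (1 / 2 + 4 * X) := by rw [abs_mul]; gcongr
  have h6 : |d3 * c| ≤ 1 * (1 / 2 + 4 * X) := by rw [abs_mul]; gcongr
  rw [abs_le] at h3 h4 h5 h6 ⊢
  have hX2 := sq_nonneg X
  constructor <;> linarith [h3.1, h3.2, h4.1, h4.2, h5.1, h5.2, h6.1, h6.2]

lemma hasDerivAt_coord (z : Fin N → ℝ) (i j : Fin N) :
    HasDerivAt (fun t : ℝ => (z + t • (Pi.single i 1 : Fin N → ℝ)) j)
      ((Pi.single i 1 : Fin N → ℝ) j) 0 := by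
  simpa using ((hasDerivAt_id (0 : ℝ)).mul_const ((Pi.single i 1 : Fin N → ℝ) j)).const_add (z j)

lemma hasLineDerivAt_heat {s : ℝ} (i : Fin N) (z : Fin N → ℝ) :
    HasLineDerivAt ℝ (heat s) (heat₁ i s z) z (Pi.single i 1) := by
  have h1 : HasDerivAt (fun t : ℝ => ∑ j, (z + t • (Pi.single i 1 : Fin N → ℝ)) j ^ 2)
      (∑ j, 2 * z j * (Pi.single i 1 : Fin N → ℝ) j) 0 := by
    refine HasDerivAt.fun_sum fun j _ => ?_
    simpa using (hasDerivAt_coord z i j).fun_pow 2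
  have h2 := ((h1.neg.div_const (4 * s)).exp).const_mul ((4 * Real.pi * s) ^ (-(N : ℝ) / 2))
  refine h2.congr_deriv ?_
  simp [heat₁, heat, Pi.single_apply]
  ring

lemma hasLineDerivAt_heat₁ {s : ℝ} (j k : Fin N) (z : Fin N → ℝ) :
    HasLineDerivAt ℝ (heat₁ j s) (heat₂ j k s z) z (Pi.single k 1) := by
  have h := (((hasDerivAt_coord z k j).div_const (2 * s)).neg).mul (hasLineDerivAt_heat (s := s) k z)
  refine h.congr_deriv ?_
  simp only [heat₁, heat₂, zero_smul, add_zero]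
  simp
  ring

lemma hasLineDerivAt_heat₂ {s : ℝ} (j k l : Fin N) (z : Fin N → ℝ) :
    HasLineDerivAt ℝ (heat₂ j k s) (heat₃ j k l s z) z (Pi.single l 1) := by
  have h := ((((hasDerivAt_coord z l j).mul (hasDerivAt_coord z l k)).div_const
    (4 * s ^ 2)).sub_const ((Pi.single k 1 : Fin N → ℝ) j / (2 * s))).mul
      (hasLineDerivAt_heat (s := s) l z)
  refine h.congr_deriv ?_
  simp only [heat₁, heat₃, zero_smul, add_zero]
  simp
  ring

lemma hasDerivAt_heat {s : ℝ} (hs : 0 < s) (z : Fin N → ℝ) :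
    HasDerivAt (fun r => heat r z) (∑ j, heat₂ j j s z) s := by
  have h1 : HasDerivAt (fun r : ℝ => (4 * Real.pi * r) ^ (-(N : ℝ) / 2))
      (-(N : ℝ) / (2 * s) * (4 * Real.pi * s) ^ (-(N : ℝ) / 2)) s := by
    have h := ((hasDerivAt_id s).const_mul (4 * Real.pi)).rpow_const (p := -(N : ℝ) / 2)
      (Or.inl (by simp only [id]; positivity))
    refine h.congr_deriv ?_
    simp only [id]
    rw [Real.rpow_sub_one (by positivity)]
    field_simp
  have h2 : HasDerivAt (fun r : ℝ => -(∑ i, z i ^ 2) / (4 * r))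
      ((∑ i, z i ^ 2) / (4 * s ^ 2)) s := by
    have h := ((hasDerivAt_id s).const_mul (4 : ℝ)).inv (by simp only [id]; positivity)
    have h' := h.const_mul (-(∑ i, z i ^ 2))
    refine (h'.congr_deriv ?_)
    simp only [id]; field_simp
  refine (h1.mul h2.exp).congr_deriv ?_
  simp only [heat₂, heat, ← Finset.sum_mul, Finset.sum_sub_distrib, Pi.single_eq_same,
    ← Finset.sum_div, Finset.sum_const, Finset.card_univ, Fintype.card_fin, nsmul_eq_mul, mul_one,
    ← sq]
  ring

/-! ### Operations on Schwartz functions -/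

/-- Real-valued Schwartz functions on `ℝ^N`. -/
abbrev Sch (N : ℕ) := 𝓢(Fin N → ℝ, ℝ)

/-- Partial differentiation on Schwartz space. -/
noncomputable def D (i : Fin N) : Sch N →L[ℝ] Sch N :=
  LineDeriv.lineDerivOpCLM ℝ (Sch N) (Pi.single i (1 : ℝ) : Fin N → ℝ)

/-- The pointwise product of Schwartz functions. -/
noncomputable def mulS (f g : Sch N) : Sch N :=
  SchwartzMap.pairing (ContinuousLinearMap.mul ℝ ℝ) f g

/-- Translation on Schwartz space. -/
noncomputable def trans (a : Fin N → ℝ) : Sch N →L[ℝ] Sch N :=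
  SchwartzMap.compSubConstCLM ℝ (-a)

@[simp] lemma mulS_apply (f g : Sch N) (x : Fin N → ℝ) : mulS f g x = f x * g x := rfl

@[simp] lemma trans_apply (a : Fin N → ℝ) (f : Sch N) (x : Fin N → ℝ) :
    trans a f x = f (x + a) := by
  simp [trans, SchwartzMap.compSubConstCLM_apply]

lemma D_apply (i : Fin N) (f : Sch N) (x : Fin N → ℝ) : D i f x = pd i f x := by
  simp [D, pd, SchwartzMap.lineDerivOp_apply_eq_fderiv]

lemma D_eq_fderiv (i : Fin N) (f : Sch N) (x : Fin N → ℝ) :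
    D i f x = fderiv ℝ f x (Pi.single i 1) := D_apply i f x

lemma hasLineDerivAt_D (i : Fin N) (f : Sch N) (x : Fin N → ℝ) :
    HasLineDerivAt ℝ f (D i f x) x (Pi.single i 1) := by
  rw [D_eq_fderiv]
  exact (f.differentiable x).hasFDerivAt.hasLineDerivAt _

lemma D_comm (i j : Fin N) (f : Sch N) : D i (D j f) = D j (D i f) := by
  ext x
  have h : ∀ (i j : Fin N),
      D i (D j f) x = fderiv ℝ (fderiv ℝ f) x (Pi.single i 1) (Pi.single j 1) := by
    intro i j
    rw [D_eq_fderiv]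
    have : (D j f : (Fin N → ℝ) → ℝ) = fun y => fderiv ℝ f y (Pi.single j 1) := by
      ext y; exact D_eq_fderiv j f y
    rw [this, fderiv_clm_apply]
    · simp
    · exact ((f.smooth 2).fderiv_right (m := 1) (by norm_num)).differentiable (by norm_num) x
    · fun_prop
  rw [h, h]
  have hs : IsSymmSndFDerivAt ℝ f x :=
    ContDiffAt.isSymmSndFDerivAt (n := 2) (f.smooth 2).contDiffAt (by simp)
  exact hs _ _

lemma D_mul (i : Fin N) (f g : Sch N) : D i (mulS f g) = mulS (D i f) g + mulS f (D i g) := by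
  ext x
  rw [D_eq_fderiv]
  have : (mulS f g : (Fin N → ℝ) → ℝ) = fun y => f y * g y := rfl
  rw [this, fderiv_fun_mul (f.differentiable x) (g.differentiable x)]
  simp [D_eq_fderiv]
  ring

lemma D_trans (i : Fin N) (a : Fin N → ℝ) (f : Sch N) : D i (trans a f) = trans a (D i f) := by
  ext x
  rw [D_eq_fderiv]
  have : (trans a f : (Fin N → ℝ) → ℝ) = fun y => f (y + a) := by ext y; simp
  rw [this, fderiv_comp_add_right]
  simp [D_eq_fderiv]

lemma exists_bound (f : Sch N) : ∃ C, 0 ≤ C ∧ ∀ x, |f x| ≤ C :=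
  ⟨_, apply_nonneg _ f, fun x => by simpa using SchwartzMap.norm_le_seminorm ℝ f x⟩

lemma integrable_mul_of_bounded {f k : (Fin N → ℝ) → ℝ} {C : ℝ} (hk : Integrable k)
    (hf : Continuous f) (hC : ∀ x, |f x| ≤ C) : Integrable (fun z => f z * k z) :=
  hk.bdd_mul hf.aestronglyMeasurable (Eventually.of_forall fun x => by simpa using hC x)

lemma integrable_mul (f : Sch N) {k : (Fin N → ℝ) → ℝ} (hk : Integrable k) :
    Integrable (fun z => f z * k z) := by
  obtain ⟨C, -, hC⟩ := exists_bound f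
  exact integrable_mul_of_bounded hk f.continuous hC

lemma integral_D_mul (i : Fin N) (f : Sch N) {k k' : (Fin N → ℝ) → ℝ} (hk : Integrable k)
    (hk' : Integrable k') (h : ∀ z, HasLineDerivAt ℝ k (k' z) z (Pi.single i 1)) :
    ∫ z, D i f z * k z = -∫ z, f z * k' z := by
  have := integral_bilinear_hasLineDerivAt_right_eq_neg_left_of_integrable (μ := volume)
    (f := k) (f' := k') (g := f) (g' := D i f) (v := Pi.single i (1:ℝ))
    (B := ContinuousLinearMap.mul ℝ ℝ)
    (by simpa [mul_comm] using integrable_mul f hk')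
    (by simpa [mul_comm] using integrable_mul (D i f) hk)
    (by simpa [mul_comm] using integrable_mul f hk)
    (fun x _ => h x) (fun x _ => hasLineDerivAt_D i f x)
  simpa [mul_comm] using this

lemma integrable_of_le_heat {k : (Fin N → ℝ) → ℝ} {C s : ℝ} (hs : 0 < s) (hk : Continuous k)
    (h : ∀ z, |k z| ≤ C * heat s z) : Integrable k :=
  ((integrable_heat hs).const_mul C).mono' hk.aestronglyMeasurable
    (Eventually.of_forall fun z => by simpa using h z)

lemma integrable_heat₁ {s : ℝ} (hs : 0 < s) (j : Fin N) : Integrable (heat₁ j s) :=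
  integrable_of_le_heat (by positivity) (by fun_prop) (abs_heat₁_le hs · j)

lemma integrable_heat₂ {s : ℝ} (hs : 0 < s) (j k : Fin N) : Integrable (heat₂ j k s) :=
  integrable_of_le_heat (by positivity) (by fun_prop) (abs_heat₂_le hs · j k)

lemma integrable_heat₃ {s : ℝ} (hs : 0 < s) (j k l : Fin N) : Integrable (heat₃ j k l s) :=
  integrable_of_le_heat (by positivity) (by fun_prop) (abs_heat₃_le hs · j k l)

lemma integral_D_heat {s : ℝ} (hs : 0 < s) (f : Sch N) (j : Fin N) :
    ∫ z, D j f z * heat s z = -∫ z, f z * heat₁ j s z :=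
  integral_D_mul j f (integrable_heat hs) (integrable_heat₁ hs j) (hasLineDerivAt_heat j)

lemma integral_D_D_heat {s : ℝ} (hs : 0 < s) (f : Sch N) (j k : Fin N) :
    ∫ z, D j (D k f) z * heat s z = ∫ z, f z * heat₂ j k s z := by
  rw [integral_D_heat hs, integral_D_mul k f (integrable_heat₁ hs j) (integrable_heat₂ hs j k)
    (hasLineDerivAt_heat₁ j k), neg_neg]

lemma integral_D_D_D_heat {s : ℝ} (hs : 0 < s) (f : Sch N) (j k l : Fin N) :
    ∫ z, D j (D k (D l f)) z * heat s z = -∫ z, f z * heat₃ j k l s z := by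
  rw [integral_D_D_heat hs, integral_D_mul l f (integrable_heat₂ hs j k) (integrable_heat₃ hs j k l)
    (hasLineDerivAt_heat₂ j k l)]

lemma integrable_abs_mul_heat (f : Sch N) {s : ℝ} (hs : 0 < s) :
    Integrable (fun z => |f z| * heat s z) := by
  simpa [abs_mul, abs_of_pos (heat_pos hs _)] using (integrable_mul f (integrable_heat hs)).abs

lemma abs_integral_mul_le {f : Sch N} {k : (Fin N → ℝ) → ℝ} {C s : ℝ} (hs : 0 < s)
    (h : ∀ z, |k z| ≤ C * heat s z) :
    |∫ z, f z * k z| ≤ C * ∫ z, |f z| * heat s z := by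
  rw [← integral_const_mul]
  refine norm_integral_le_of_norm_le (f := fun z => f z * k z)
    ((integrable_abs_mul_heat f hs).const_mul C) (Eventually.of_forall fun z => ?_)
  rw [Real.norm_eq_abs, abs_mul]
  nlinarith [h z, abs_nonneg (f z)]

lemma abs_integral_heat_le (f : Sch N) {s : ℝ} (hs : 0 < s) :
    |∫ z, f z * heat s z| ≤ ∫ z, |f z| * heat s z := by
  simpa using abs_integral_mul_le (f := f) (k := heat s) (C := 1) hs
    (fun z => by rw [abs_of_pos (heat_pos hs z), one_mul])

lemma abs_integral_D_heat_le (f : Sch N) {s : ℝ} (hs : 0 < s) (j : Fin N) :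
    |∫ z, D j f z * heat s z| ≤ heatC N * s ^ (-(1 / 2) : ℝ) * ∫ z, |f z| * heat (2 * s) z := by
  rw [integral_D_heat hs, abs_neg]
  exact abs_integral_mul_le (by positivity) (abs_heat₁_le hs · j)

lemma abs_integral_D_D_D_heat_le (f : Sch N) {s : ℝ} (hs : 0 < s) (j k l : Fin N) :
    |∫ z, D j (D k (D l f)) z * heat s z| ≤
      heatC N * s ^ (-(3 / 2) : ℝ) * ∫ z, |f z| * heat (2 * s) z := by
  rw [integral_D_D_D_heat hs, abs_neg]
  exact abs_integral_mul_le (by positivity) (abs_heat₃_le hs · j k l)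

lemma integral_abs_heat_le {f : Sch N} {s M : ℝ} (hs : 0 < s) (h : ∀ x, |f x| ≤ M) :
    ∫ z, |f z| * heat s z ≤ M := by
  calc ∫ z, |f z| * heat s z ≤ ∫ z, M * heat s z :=
        integral_mono (integrable_abs_mul_heat f hs) ((integrable_heat hs).const_mul M)
          fun z => mul_le_mul_of_nonneg_right (h z) (heat_pos hs z).le
    _ = M := by rw [integral_const_mul, integral_heat hs, mul_one]

lemma integrable_abs_rpow (f : Sch N) {p : ℝ} (hp : 0 < p) : Integrable (fun x => |f x| ^ p) := by
  have := (f.memLp (ENNReal.ofReal p) volume).integrable_norm_rpow (by simpa using hp) (by simp)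
  simpa [ENNReal.toReal_ofReal hp.le] using this

/-- Smoothing of `L^p` functions by the heat kernel. -/
lemma integral_abs_heat_le_of_Lp {f : Sch N} {s p A : ℝ} (hs : 0 < s) (hp : 1 ≤ p)
    (h : ∫ x, |f x| ^ p ≤ A) :
    ∫ z, |f z| * heat s z ≤ (1 + A) * s ^ (-((N : ℝ) / (2 * p))) := by
  set l : ℝ := s ^ (-((N : ℝ) / (2 * p))) with hl
  have hl0 : 0 < l := by positivity
  have key : ∀ y : ℝ, 0 ≤ y → y ≤ l + l ^ (1 - p) * y ^ p := by
    intro y hy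
    rcases le_total y l with h1 | h1
    · have : 0 ≤ l ^ (1 - p) * y ^ p := by positivity
      linarith
    · have hy0 : 0 < y := hl0.trans_le h1
      have h2 : y ^ (1 - p) ≤ l ^ (1 - p) :=
        Real.rpow_le_rpow_of_nonpos hl0 h1 (by linarith)
      have h3 : y = y ^ (1 - p) * y ^ p := by
        rw [← Real.rpow_add hy0]; simp
      have : y ^ (1 - p) * y ^ p ≤ l ^ (1 - p) * y ^ p := by gcongr
      linarith
  have h2 : l ^ (1 - p) * s ^ (-(N : ℝ) / 2) = l := by
    rw [hl, ← Real.rpow_mul hs.le, ← Real.rpow_add hs]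
    congr 1
    field_simp
    ring
  calc ∫ z, |f z| * heat s z
      ≤ ∫ z, (l * heat s z + l * |f z| ^ p) := by
        refine integral_mono (integrable_abs_mul_heat f hs)
          (((integrable_heat hs).const_mul l).add ((integrable_abs_rpow f (by linarith)).const_mul l))
          fun z => ?_
        have h0 := (heat_pos hs z).le
        have h4 : l ^ (1 - p) * |f z| ^ p * heat s z ≤ l * |f z| ^ p := by
          calc l ^ (1 - p) * |f z| ^ p * heat s z
              ≤ l ^ (1 - p) * |f z| ^ p * s ^ (-(N : ℝ) / 2) := by
                gcongr; exact heat_le_sup hs z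
            _ = (l ^ (1 - p) * s ^ (-(N : ℝ) / 2)) * |f z| ^ p := by ring
            _ = l * |f z| ^ p := by rw [h2]
        have h5 := mul_le_mul_of_nonneg_right (key |f z| (abs_nonneg _)) h0
        simp only
        linarith
    _ = l + l * ∫ x, |f x| ^ p := by
        rw [integral_add ((integrable_heat hs).const_mul l)
          ((integrable_abs_rpow f (by linarith)).const_mul l), integral_const_mul,
          integral_const_mul, integral_heat hs, mul_one]
    _ ≤ (1 + A) * l := by nlinarith

/-! ### Differences and derivatives -/

/-- The forward difference with step `h`. -/
noncomputable def dif (h : Fin N → ℝ) : Sch N →L[ℝ] Sch N :=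
  trans h - ContinuousLinearMap.id ℝ _

@[simp] lemma dif_apply (h : Fin N → ℝ) (f : Sch N) (x : Fin N → ℝ) :
    dif h f x = f (x + h) - f x := by
  simp [dif]

lemma D_dif (i : Fin N) (h : Fin N → ℝ) (f : Sch N) : D i (dif h f) = dif h (D i f) := by
  simp [dif, D_trans]

lemma abs_dif_le {f : Sch N} {M : ℝ} (hM : ∀ j x, |D j f x| ≤ M) (h x : Fin N → ℝ) :
    |dif h f x| ≤ N * M * ‖h‖ := by
  have key : ∀ y, ‖fderiv ℝ f y‖ ≤ N * M := by
    intro y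
    have hM0 : 0 ≤ N * M := by
      rcases Nat.eq_zero_or_pos N with h0 | h0
      · subst h0; simp
      · have := (abs_nonneg _).trans (hM ⟨0, h0⟩ y)
        positivity
    refine ContinuousLinearMap.opNorm_le_bound _ hM0 fun z => ?_
    have hz : fderiv ℝ f y z = ∑ j, z j * D j f y := by
      conv_lhs => rw [pi_eq_sum_univ' z, map_sum]
      refine Finset.sum_congr rfl fun j _ => ?_
      rw [map_smul, D_eq_fderiv, smul_eq_mul]
    rw [hz, Real.norm_eq_abs]
    calc |∑ j, z j * D j f y| ≤ ∑ j, |z j * D j f y| := Finset.abs_sum_le_sum_abs _ _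
      _ ≤ ∑ _j : Fin N, ‖z‖ * M := by
        refine Finset.sum_le_sum fun j _ => ?_
        rw [abs_mul]
        exact mul_le_mul (norm_le_pi_norm z j) (hM j y) (abs_nonneg _) (norm_nonneg _)
      _ = N * M * ‖z‖ := by simp; ring
  have := Convex.norm_image_sub_le_of_norm_fderiv_le (𝕜 := ℝ) (f := f) (s := univ)
    (fun y _ => f.differentiable y) (fun y _ => key y) convex_univ (mem_univ x) (mem_univ (x + h))
  simpa using this

lemma abs_D_le_of_dif {f : Sch N} {M : ℝ} (hM : ∀ h x, |dif h f x| ≤ M * ‖h‖) (j : Fin N)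
    (x : Fin N → ℝ) : |D j f x| ≤ M := by
  have h1 := (hasLineDerivAt_D j f x).tendsto_slope_zero.abs
  refine le_of_tendsto h1 (eventually_nhdsWithin_of_forall fun t ht => ?_)
  have ht : t ≠ 0 := ht
  have h2 := hM (t • Pi.single j 1) x
  rw [norm_smul, Pi.norm_single, norm_one, mul_one, Real.norm_eq_abs, dif_apply] at h2
  rw [smul_eq_mul, abs_mul, abs_inv, inv_mul_le_iff₀ (abs_pos.2 ht), mul_comm]
  exact h2

lemma abs_dif_dif_le {f : Sch N} {M : ℝ} (hM : ∀ j k x, |D j (D k f) x| ≤ M)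
    (h h' x : Fin N → ℝ) : |dif h (dif h' f) x| ≤ N * (N * M) * ‖h‖ * ‖h'‖ := by
  have := abs_dif_le (f := dif h' f) (M := N * M * ‖h'‖) (fun j y => by
    rw [D_dif]; exact abs_dif_le (fun k z => hM k j z) h' y) h x
  linarith

lemma abs_D_D_le_of_dif {f : Sch N} {M : ℝ}
    (hM : ∀ h h' x, |dif h (dif h' f) x| ≤ M * ‖h‖ * ‖h'‖) (j k : Fin N)
    (x : Fin N → ℝ) : |D j (D k f) x| ≤ M := by
  refine abs_D_le_of_dif (fun h x => ?_) j x
  rw [← D_dif]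
  refine abs_D_le_of_dif (fun h' x => ?_) k x
  linarith [hM h' h x]

/-! ### Differentiation of heat averages -/

lemma heat_le_of_mem {d s : ℝ} (hd : 0 < d) (hs : d / 2 < s) (hs' : s ≤ 3 * d) (z : Fin N → ℝ) :
    heat s z ≤ (6 : ℝ) ^ ((N : ℝ) / 2) * heat (3 * d) z := by
  refine (heat_le_heat (by linarith) hs' z).trans ?_
  have := heat_pos (show 0 < 3 * d by positivity) z
  have h6 : 3 * d / s ≤ 6 := by rw [div_le_iff₀ (by linarith)]; linarith
  have : 0 ≤ 3 * d / s := div_nonneg (by linarith) (by linarith)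
  gcongr

lemma hasDerivAt_integral_heat {f f' : ℝ → (Fin N → ℝ) → ℝ} {r₀ σ ρ C : ℝ} (hρ : 0 < ρ)
    (hσ : r₀ < σ) (hf : ∀ r ∈ Metric.ball r₀ ρ, ∀ z, HasDerivAt (f · z) (f' r z) r)
    (hC : ∀ r ∈ Metric.ball r₀ ρ, ∀ z, |f r z| ≤ C)
    (hC' : ∀ r ∈ Metric.ball r₀ ρ, ∀ z, |f' r z| ≤ C)
    (hc : ∀ r ∈ Metric.ball r₀ ρ, Continuous (f r)) (hc' : Continuous (f' r₀)) :
    HasDerivAt (fun r => ∫ z, f r z * heat (σ - r) z)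
      ((∫ z, f' r₀ z * heat (σ - r₀) z) - ∫ z, f r₀ z * ∑ j, heat₂ j j (σ - r₀) z) r₀ := by
  obtain ⟨d, hd⟩ : ∃ d, d = σ - r₀ := ⟨_, rfl⟩
  have hd0 : 0 < d := by linarith
  have hC0 : 0 ≤ C := (abs_nonneg _).trans (hC r₀ (Metric.mem_ball_self hρ) 0)
  have hN := heatC_pos N
  obtain ⟨B, hB, hB0⟩ : ∃ B : ℝ, B = (6 : ℝ) ^ ((N : ℝ) / 2) ∧ 0 ≤ B := ⟨_, rfl, by positivity⟩
  have hsub : Metric.ball r₀ (min ρ (d / 2)) ⊆ Metric.ball r₀ ρ :=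
    Metric.ball_subset_ball (min_le_left _ _)
  have hsr : ∀ r ∈ Metric.ball r₀ (min ρ (d / 2)), d / 2 < σ - r ∧ σ - r < 3 / 2 * d := by
    intro r hr
    have := (Metric.mem_ball.1 hr).trans_le (min_le_right _ _)
    rw [Real.dist_eq, abs_lt] at this
    constructor <;> linarith [this.1, this.2]
  have hh : ∀ s, d / 2 < s → s ≤ 3 * d → ∀ z : Fin N → ℝ, heat s z ≤ B * heat (3 * d) z :=
    fun s h1 h2 z => hB ▸ heat_le_of_mem hd0 h1 h2 z
  have hh₂ : ∀ r ∈ Metric.ball r₀ (min ρ (d / 2)), ∀ (z : Fin N → ℝ) j,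
      |heat₂ j j (σ - r) z| ≤ heatC N * (2 / d) * (B * heat (3 * d) z) := by
    intro r hr z j
    obtain ⟨h1, h2⟩ := hsr r hr
    have h3 : 0 < σ - r := by linarith
    refine (abs_heat₂_le h3 z j j).trans ?_
    have h4 := hh (2 * (σ - r)) (by linarith) (by linarith) z
    have h5 : (σ - r) ^ (-1 : ℝ) ≤ 2 / d := by
      rw [Real.rpow_neg_one, inv_le_comm₀ h3 (by positivity), inv_div]
      exact h1.le
    have := heat_pos (show 0 < 2 * (σ - r) by positivity) z
    gcongr
  have h := hasDerivAt_integral_of_dominated_loc_of_deriv_le (μ := (volume : Measure (Fin N → ℝ)))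
    (F := fun r z => f r z * heat (σ - r) z)
    (F' := fun r z => f' r z * heat (σ - r) z - f r z * ∑ j, heat₂ j j (σ - r) z)
    (x₀ := r₀) (s := Metric.ball r₀ (min ρ (d / 2)))
    (bound := fun z => C * (B * heat (3 * d) z) +
      C * (N * (heatC N * (2 / d) * (B * heat (3 * d) z))))
    (Metric.ball_mem_nhds _ (by positivity))
    (by
      filter_upwards [Metric.ball_mem_nhds r₀ hρ] with r hr
      have := hc r hr
      exact Continuous.aestronglyMeasurable (by fun_prop))
    (integrable_mul_of_bounded (integrable_heat (by linarith))
      (hc r₀ (Metric.mem_ball_self hρ)) (hC r₀ (Metric.mem_ball_self hρ)))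
    (by
      have := hc r₀ (Metric.mem_ball_self hρ)
      exact Continuous.aestronglyMeasurable (by fun_prop))
    (Eventually.of_forall fun z r hr => by
      have h1 := hC r (hsub hr) z
      have h2 := hC' r (hsub hr) z
      obtain ⟨h3, h4⟩ := hsr r hr
      have h5 := heat_pos (show 0 < σ - r by linarith) z
      have h6 := hh (σ - r) (by linarith) (by linarith) z
      have h7 : |∑ j, heat₂ j j (σ - r) z| ≤ N * (heatC N * (2 / d) * (B * heat (3 * d) z)) := by
        refine (Finset.abs_sum_le_sum_abs _ _).trans ?_
        refine (Finset.sum_le_sum fun j _ => hh₂ r hr z j).trans ?_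
        simp
      refine (norm_sub_le _ _).trans (add_le_add ?_ ?_)
      · rw [Real.norm_eq_abs, abs_mul, abs_of_pos h5]
        exact mul_le_mul h2 h6 h5.le hC0
      · rw [Real.norm_eq_abs, abs_mul]
        exact mul_le_mul h1 h7 (abs_nonneg _) hC0)
    (by
      have := integrable_heat (N := N) (show 0 < 3 * d by positivity)
      fun_prop)
    (Eventually.of_forall fun z r hr => by
      obtain ⟨h3, h4⟩ := hsr r hr
      have h8 : HasDerivAt (fun r => heat (σ - r) z) (-∑ j, heat₂ j j (σ - r) z) r := by
        have h9 : HasDerivAt (fun r => σ - r) (-1) r := (hasDerivAt_id r).const_sub σ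
        have := (hasDerivAt_heat (show 0 < σ - r by linarith) z).comp r h9
        simpa [Function.comp_def] using this
      have := (hf r (hsub hr) z).mul h8
      rw [mul_neg, ← sub_eq_add_neg] at this
      exact this)
  have h1 := h.2
  rw [integral_sub] at h1
  · exact h1
  · exact integrable_mul_of_bounded (integrable_heat (by linarith)) hc'
      (hC' r₀ (Metric.mem_ball_self hρ))
  · refine integrable_mul_of_bounded ?_ (hc r₀ (Metric.mem_ball_self hρ))
      (hC r₀ (Metric.mem_ball_self hρ))
    exact integrable_finsetSum _ fun j _ => integrable_heat₂ (by linarith) j j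

lemma integral_sum_heat₂ (f : Sch N) {s : ℝ} (hs : 0 < s) :
    ∫ z, f z * ∑ j, heat₂ j j s z = ∫ z, (∑ j, D j (D j f)) z * heat s z := by
  simp_rw [sum_apply, Finset.sum_mul, Finset.mul_sum]
  rw [integral_finsetSum _ fun j _ => integrable_mul f (integrable_heat₂ hs j j),
    integral_finsetSum _ fun j _ => integrable_mul (D j (D j f)) (integrable_heat hs)]
  exact Finset.sum_congr rfl fun j _ => (integral_D_D_heat hs f j j).symm

/-- Heat averages solve the heat equation. -/
lemma hasDerivAt_heat_average (f : Sch N) {s : ℝ} (hs : 0 < s) :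
    HasDerivAt (fun s => ∫ z, f z * heat s z) (∫ z, (∑ j, D j (D j f)) z * heat s z) s := by
  obtain ⟨C, hC0, hC⟩ := exists_bound f
  have h := hasDerivAt_integral_heat (f := fun _ => f) (f' := fun _ _ => 0) (r₀ := s) (σ := 2 * s)
    (ρ := 1) (C := C) one_pos (by linarith) (fun r _ z => hasDerivAt_const r (f z))
    (fun _ _ => hC) (fun _ _ _ => by simpa using hC0) (fun _ _ => f.continuous) continuous_const
  rw [show 2 * s - s = s by ring, integral_sum_heat₂ f hs] at h
  have h9 : HasDerivAt (fun r => 2 * s - r) (-1) s := (hasDerivAt_id s).const_sub _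
  have h' := HasDerivAt.comp (h₂ := fun r => ∫ z, f z * heat (2 * s - r) z) s
    (by rw [show 2 * s - s = s by ring]; exact h) h9
  simpa [Function.comp_def] using h'

/-- Heat averages approximate point values. -/
lemma abs_apply_zero_le {f : Sch N} {A : ℝ}
    (h : ∀ ε : ℝ, 0 < ε → ε ≤ 1 → |∫ z, f z * heat ε z| ≤ A) : |f 0| ≤ A := by
  have hb : ∃ K, 0 ≤ K ∧ ∀ x, |f x - f 0| ≤ K * ‖x‖ := by
    choose c hc0 hc using fun j => exists_bound (D j f)
    refine ⟨N * ∑ j, c j, mul_nonneg (by positivity) (Finset.sum_nonneg fun j _ => hc0 j),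
      fun x => ?_⟩
    have := abs_dif_le (f := f) (M := ∑ j, c j) (fun j x => (hc j x).trans
      (Finset.single_le_sum (fun j _ => hc0 j) (Finset.mem_univ j))) x 0
    simpa using this
  obtain ⟨K, hK0, hK⟩ := hb
  have hnorm : ∀ z : Fin N → ℝ, ‖z‖ ≤ ∑ j, |z j| := fun z =>
    (pi_norm_le_iff_of_nonneg (Finset.sum_nonneg fun j _ => abs_nonneg _)).2 fun j =>
      Finset.single_le_sum (f := fun j => |z j|) (fun j _ => abs_nonneg _) (Finset.mem_univ j)
  have key : ∀ ε : ℝ, 0 < ε → ε ≤ 1 →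
      |f 0| ≤ A + K * (N * (2 * heatC N)) * ε ^ (1 / 2 : ℝ) := by
    intro ε hε hε1
    have hpt : ∀ z, |(f z - f 0) * heat ε z| ≤
        K * (N * (2 * heatC N)) * ε ^ (1 / 2 : ℝ) * heat (2 * ε) z := by
      intro z
      have h0 := heat_pos hε z
      rw [abs_mul, abs_of_pos h0]
      have h1 : ∀ j, |z j| * heat ε z ≤ 2 * heatC N * ε ^ (1 / 2 : ℝ) * heat (2 * ε) z := by
        intro j
        have h2 := abs_heat₁_le hε z j
        have h3 : |z j| * heat ε z = 2 * ε * |heat₁ j ε z| := by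
          rw [heat₁, abs_mul, abs_neg, abs_div, abs_of_pos h0,
            abs_of_pos (show 0 < 2 * ε by positivity)]
          field_simp
        have h4 : ε * ε ^ (-(1 / 2) : ℝ) = ε ^ (1 / 2 : ℝ) := by
          conv_lhs => rw [← Real.rpow_one_add' hε.le (by norm_num)]
          norm_num
        rw [h3, ← h4]
        nlinarith [mul_le_mul_of_nonneg_left h2 hε.le]
      calc |f z - f 0| * heat ε z ≤ (K * ∑ j, |z j|) * heat ε z := by
            gcongr
            exact (hK z).trans (mul_le_mul_of_nonneg_left (hnorm z) hK0)
        _ = K * ∑ j, |z j| * heat ε z := by rw [mul_assoc, Finset.sum_mul]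
        _ ≤ K * ∑ _j : Fin N, 2 * heatC N * ε ^ (1 / 2 : ℝ) * heat (2 * ε) z := by
            exact mul_le_mul_of_nonneg_left (Finset.sum_le_sum fun j _ => h1 j) hK0
        _ = _ := by simp; ring
    have h5 : f 0 = (∫ z, f z * heat ε z) - ∫ z, (f z - f 0) * heat ε z := by
      simp_rw [sub_mul]
      rw [integral_sub (integrable_mul f (integrable_heat hε)) ((integrable_heat hε).const_mul _),
        integral_const_mul, integral_heat hε]
      ring
    have h6 : |∫ z, (f z - f 0) * heat ε z| ≤ K * (N * (2 * heatC N)) * ε ^ (1 / 2 : ℝ) := by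
      refine (norm_integral_le_of_norm_le (f := fun z => (f z - f 0) * heat ε z)
        ((integrable_heat (show 0 < 2 * ε by positivity)).const_mul _)
        (Eventually.of_forall hpt)).trans ?_
      rw [integral_const_mul, integral_heat (by positivity), mul_one]
    rw [h5]
    exact (abs_sub _ _).trans (add_le_add (h ε hε hε1) h6)
  have hlim : Tendsto (fun ε : ℝ => A + K * (N * (2 * heatC N)) * ε ^ (1 / 2 : ℝ)) (𝓝[>] 0)
      (𝓝 (A + K * (N * (2 * heatC N)) * (0 : ℝ) ^ (1 / 2 : ℝ))) := by
    refine Tendsto.mono_left (Continuous.tendsto ?_ 0) nhdsWithin_le_nhds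
    exact continuous_const.add (continuous_const.mul (Real.continuous_rpow_const (by norm_num)))
  rw [Real.zero_rpow (by norm_num), mul_zero, add_zero] at hlim
  refine ge_of_tendsto hlim ?_
  filter_upwards [Ioc_mem_nhdsGT (zero_lt_one' ℝ)] with ε hε
  exact key ε hε.1 hε.2

/-- A function whose derivative is dominated by that of `b` grows at most as `b` does. -/
lemma abs_sub_le_of_deriv_le {F F' b b' : ℝ → ℝ} {a t : ℝ} (hat : a ≤ t)
    (hF : ContinuousOn F (Icc a t)) (hb : ContinuousOn b (Icc a t))
    (hF' : ∀ r ∈ Ioo a t, HasDerivAt F (F' r) r) (hb' : ∀ r ∈ Ioo a t, HasDerivAt b (b' r) r)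
    (h : ∀ r ∈ Ioo a t, |F' r| ≤ b' r) : |F t - F a| ≤ b t - b a := by
  have h1 : MonotoneOn (fun r => b r - F r) (Icc a t) := by
    refine monotoneOn_of_deriv_nonneg (convex_Icc a t) (hb.sub hF) ?_ ?_
    · rw [interior_Icc]
      exact fun r hr => ((hb' r hr).sub (hF' r hr)).differentiableAt.differentiableWithinAt
    · rw [interior_Icc]
      intro r hr
      rw [((hb' r hr).fun_sub (hF' r hr)).deriv]
      linarith [(abs_le.1 (h r hr)).2]
  have h2 : MonotoneOn (fun r => b r + F r) (Icc a t) := by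
    refine monotoneOn_of_deriv_nonneg (convex_Icc a t) (hb.add hF) ?_ ?_
    · rw [interior_Icc]
      exact fun r hr => ((hb' r hr).add (hF' r hr)).differentiableAt.differentiableWithinAt
    · rw [interior_Icc]
      intro r hr
      rw [((hb' r hr).fun_add (hF' r hr)).deriv]
      linarith [(abs_le.1 (h r hr)).1]
  have h3 := h1 (left_mem_Icc.2 hat) (right_mem_Icc.2 hat) hat
  have h4 := h2 (left_mem_Icc.2 hat) (right_mem_Icc.2 hat) hat
  simp only at h3 h4
  rw [abs_le]; constructor <;> linarith

/-! ### Estimates for the pressure -/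

lemma abs_integral_sum_sum_le {w : Fin N → Fin N → Sch N} {k : (Fin N → ℝ) → ℝ} {B : ℝ}
    (hk : Integrable k) (h : ∀ j l, |∫ z, w j l z * k z| ≤ B) :
    |∫ z, (∑ j, ∑ l, w j l) z * k z| ≤ N * N * B := by
  simp_rw [sum_apply, Finset.sum_mul]
  rw [integral_finsetSum _ fun j _ => integrable_finsetSum _ fun l _ => integrable_mul _ hk]
  simp_rw [integral_finsetSum _ fun l _ => integrable_mul _ hk]
  calc _ ≤ ∑ j, ∑ l, |∫ z, w j l z * k z| :=
        (Finset.abs_sum_le_sum_abs _ _).trans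
          (Finset.sum_le_sum fun j _ => Finset.abs_sum_le_sum_abs _ _)
    _ ≤ ∑ _j : Fin N, ∑ _l : Fin N, B :=
        Finset.sum_le_sum fun j _ => Finset.sum_le_sum fun l _ => h j l
    _ = N * N * B := by simp; ring

lemma hasDerivAt_pressure {w : Fin N → Fin N → Sch N} {θ : Sch N}
    (heq : ∑ j, D j (D j θ) = -∑ j, ∑ k, D j (D k (w j k))) (i : Fin N) {s : ℝ} (hs : 0 < s) :
    HasDerivAt (fun s => ∫ z, D i θ z * heat s z)
      (-∫ z, (∑ j, ∑ k, D j (D k (D i (w j k)))) z * heat s z) s := by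
  have h := hasDerivAt_heat_average (D i θ) hs
  have h1 : ∑ j, D j (D j (D i θ)) = -∑ j, ∑ k, D j (D k (D i (w j k))) := by
    have := congrArg (D i) heq
    simp only [map_sum, map_neg] at this
    simp_rw [D_comm i _] at this
    convert this using 1
  rw [h1] at h
  simpa [integral_neg] using h

/-- Heat averages of the pressure gradient decay when the source does. -/
lemma abs_integral_pressure_le {w : Fin N → Fin N → Sch N} {θ : Sch N}
    (heq : ∑ j, D j (D j θ) = -∑ j, ∑ k, D j (D k (w j k))) {M α τ : ℝ} (hτ : 0 < τ)
    (hα : 0 ≤ α)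
    (hM : ∀ j k s, τ ≤ s → ∫ z, |w j k z| * heat (2 * s) z ≤ M * s ^ (-α)) (i : Fin N) :
    |∫ z, D i θ z * heat τ z| ≤ 2 * (N * N * (heatC N * M)) * τ ^ (-(1 / 2) - α) := by
  have hC := heatC_pos N
  have hM0 : 0 ≤ M := by
    have h1 := hM i i τ le_rfl
    have h2 : 0 ≤ ∫ z, |w i i z| * heat (2 * τ) z :=
      integral_nonneg fun z => mul_nonneg (abs_nonneg _) (heat_pos (by positivity) z).le
    have h3 : 0 < τ ^ (-α) := by positivity
    nlinarith
  set B : ℝ := N * N * (heatC N * M) with hB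
  have hB0 : 0 ≤ B := by positivity
  obtain ⟨c, hc0, hc⟩ := exists_bound θ
  have hd : ∀ s, τ ≤ s → |-∫ z, (∑ j, ∑ k, D j (D k (D i (w j k)))) z * heat s z| ≤
      B * s ^ (-(3 / 2) - α) := by
    intro s hs
    have hs0 : 0 < s := by linarith
    rw [abs_neg]
    refine (abs_integral_sum_sum_le (B := heatC N * M * s ^ (-(3 / 2) - α)) (integrable_heat hs0)
      fun j k => ?_).trans (by rw [hB]; linarith)
    refine (abs_integral_D_D_D_heat_le (w j k) hs0 j k i).trans ?_
    calc heatC N * s ^ (-(3 / 2) : ℝ) * ∫ z, |w j k z| * heat (2 * s) z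
        ≤ heatC N * s ^ (-(3 / 2) : ℝ) * (M * s ^ (-α)) := by
          gcongr; exact hM j k s hs
      _ = _ := by rw [sub_eq_add_neg, Real.rpow_add hs0]; ring
  have key : ∀ R, τ < R → |∫ z, D i θ z * heat τ z| ≤
      heatC N * c * R ^ (-(1 / 2) : ℝ) + 2 * B * τ ^ (-(1 / 2) - α) := by
    intro R hR
    have hb : ∀ r : ℝ, 0 < r → HasDerivAt
        (fun s : ℝ => -(B / (1 / 2 + α)) * s ^ (-(1 / 2) - α)) (B * r ^ (-(3 / 2) - α)) r := by
      intro r hr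
      have := (Real.hasDerivAt_rpow_const (x := r) (p := -(1 / 2) - α) (Or.inl hr.ne')).const_mul
        (-(B / (1 / 2 + α)))
      refine this.congr_deriv ?_
      have : 0 < 1 / 2 + α := by linarith
      rw [show -(1 / 2) - α - 1 = -(3 / 2) - α by ring]
      field_simp
      ring
    have h1 := abs_sub_le_of_deriv_le (a := τ) (t := R)
      (b := fun s : ℝ => -(B / (1 / 2 + α)) * s ^ (-(1 / 2) - α))
      (b' := fun r : ℝ => B * r ^ (-(3 / 2) - α)) hR.le
      (fun r hr => (hasDerivAt_pressure heq i
        (hτ.trans_le hr.1)).continuousAt.continuousWithinAt)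
      (fun r hr => (hb r (hτ.trans_le hr.1)).continuousAt.continuousWithinAt)
      (fun r hr => hasDerivAt_pressure heq i (hτ.trans hr.1))
      (fun r hr => hb r (hτ.trans hr.1)) (fun r hr => hd r hr.1.le)
    have hR0 : 0 < R := by linarith
    have h2 := abs_integral_D_heat_le θ hR0 i
    have h3 : heatC N * R ^ (-(1 / 2) : ℝ) * ∫ z, |θ z| * heat (2 * R) z ≤
        heatC N * c * R ^ (-(1 / 2) : ℝ) := by
      have := integral_abs_heat_le (s := 2 * R) (by positivity) hc
      have h5 : 0 ≤ heatC N * R ^ (-(1 / 2) : ℝ) := by positivity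
      nlinarith
    have h4 : 0 ≤ (B / (1 / 2 + α)) * R ^ (-(1 / 2) - α) := by positivity
    have h5 : (B / (1 / 2 + α)) * τ ^ (-(1 / 2) - α) ≤ 2 * B * τ ^ (-(1 / 2) - α) := by
      have : B / (1 / 2 + α) ≤ 2 * B := by
        rw [div_le_iff₀ (by linarith)]; nlinarith
      gcongr
    have h6 := abs_sub_abs_le_abs_sub (∫ z, D i θ z * heat τ z) (∫ z, D i θ z * heat R z)
    rw [abs_sub_comm] at h6
    linarith
  have hlim : Tendsto (fun R : ℝ => heatC N * c * R ^ (-(1 / 2) : ℝ) +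
      2 * B * τ ^ (-(1 / 2) - α)) atTop (𝓝 (heatC N * c * 0 + 2 * B * τ ^ (-(1 / 2) - α))) :=
    ((tendsto_rpow_neg_atTop (by norm_num : (0 : ℝ) < 1 / 2)).const_mul _).add_const _
  rw [mul_zero, zero_add] at hlim
  refine ge_of_tendsto hlim ?_
  filter_upwards [eventually_gt_atTop τ] with R hR
  exact key R hR

/-- Heat averages of the divergence-form nonlinearity together with the pressure gradient. -/
lemma abs_integral_nonlinear_le {w : Fin N → Fin N → Sch N} {θ : Sch N}
    (heq : ∑ j, D j (D j θ) = -∑ j, ∑ k, D j (D k (w j k))) {M α τ : ℝ} (hτ : 0 < τ)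
    (hα : 0 ≤ α)
    (hM : ∀ j k s, τ ≤ s → ∫ z, |w j k z| * heat (2 * s) z ≤ M * s ^ (-α)) (i : Fin N) :
    |∫ z, (∑ j, D j (w j i) + D i θ) z * heat τ z| ≤
      (N * heatC N + 2 * (N * N * heatC N)) * M * τ ^ (-(1 / 2) - α) := by
  have hC := heatC_pos N
  have h1 : ∫ z, (∑ j, D j (w j i) + D i θ) z * heat τ z =
      ∑ j, (∫ z, D j (w j i) z * heat τ z) + ∫ z, D i θ z * heat τ z := by
    simp_rw [add_apply, sum_apply, add_mul, Finset.sum_mul]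
    rw [integral_add (integrable_finsetSum _ fun j _ => integrable_mul _ (integrable_heat hτ))
      (integrable_mul _ (integrable_heat hτ)),
      integral_finsetSum _ fun j _ => integrable_mul _ (integrable_heat hτ)]
  have h2 : ∀ j, |∫ z, D j (w j i) z * heat τ z| ≤ heatC N * M * τ ^ (-(1 / 2) - α) := by
    intro j
    refine (abs_integral_D_heat_le (w j i) hτ j).trans ?_
    calc heatC N * τ ^ (-(1 / 2) : ℝ) * ∫ z, |w j i z| * heat (2 * τ) z
        ≤ heatC N * τ ^ (-(1 / 2) : ℝ) * (M * τ ^ (-α)) := by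
          gcongr; exact hM j i τ le_rfl
      _ = _ := by rw [sub_eq_add_neg, Real.rpow_add hτ]; ring
  rw [h1]
  calc _ ≤ ∑ j, |∫ z, D j (w j i) z * heat τ z| + |∫ z, D i θ z * heat τ z| :=
        (abs_add_le _ _).trans (add_le_add_left (Finset.abs_sum_le_sum_abs _ _) _)
    _ ≤ ∑ _j : Fin N, heatC N * M * τ ^ (-(1 / 2) - α) +
        2 * (N * N * (heatC N * M)) * τ ^ (-(1 / 2) - α) :=
        add_le_add (Finset.sum_le_sum fun j _ => h2 j) (abs_integral_pressure_le heq hτ hα hM i)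
    _ = _ := by simp; ring

/-- A pointwise bound for the pressure gradient. -/
lemma abs_pressure_gradient_zero_le {w : Fin N → Fin N → Sch N} {θ : Sch N}
    (heq : ∑ j, D j (D j θ) = -∑ j, ∑ k, D j (D k (w j k))) {M : ℝ}
    (hw : ∀ j k x, |w j k x| ≤ M) (hw₂ : ∀ j k x, |D j (D k (w j k)) x| ≤ M) (i : Fin N) :
    |D i θ 0| ≤ 4 * (N * N * (heatC N * M)) := by
  have hC := heatC_pos N
  have hM0 : 0 ≤ M := (abs_nonneg _).trans (hw i i 0)
  set B : ℝ := N * N * (heatC N * M) with hB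
  have hB0 : 0 ≤ B := by positivity
  have h1 : |∫ z, D i θ z * heat 1 z| ≤ 2 * B := by
    have := abs_integral_pressure_le heq one_pos le_rfl (M := M) (fun j k s hs => by
      rw [neg_zero, Real.rpow_zero, mul_one]
      exact integral_abs_heat_le (by linarith) (hw j k)) i
    simpa using this
  have hd : ∀ s : ℝ, 0 < s → |-∫ z, (∑ j, ∑ k, D j (D k (D i (w j k)))) z * heat s z| ≤
      B * s ^ (-(1 / 2) : ℝ) := by
    intro s hs0
    rw [abs_neg]
    refine (abs_integral_sum_sum_le (B := heatC N * M * s ^ (-(1 / 2) : ℝ)) (integrable_heat hs0)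
      fun j k => ?_).trans (by rw [hB]; linarith)
    rw [D_comm k i, D_comm j i]
    refine (abs_integral_D_heat_le _ hs0 i).trans ?_
    have := integral_abs_heat_le (s := 2 * s) (by positivity) (hw₂ j k)
    have h5 : 0 ≤ heatC N * s ^ (-(1 / 2) : ℝ) := by positivity
    nlinarith
  refine abs_apply_zero_le fun ε hε hε1 => ?_
  have hb : ∀ r : ℝ, 0 < r → HasDerivAt
      (fun s : ℝ => 2 * B * s ^ (1 / 2 : ℝ)) (B * r ^ (-(1 / 2) : ℝ)) r := by
    intro r hr
    have := (Real.hasDerivAt_rpow_const (x := r) (p := 1 / 2) (Or.inl hr.ne')).const_mul (2 * B)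
    refine this.congr_deriv ?_
    rw [show (1 / 2 - 1 : ℝ) = -(1 / 2) by norm_num]
    ring
  have h2 := abs_sub_le_of_deriv_le (a := ε) (t := 1)
      (b := fun s : ℝ => 2 * B * s ^ (1 / 2 : ℝ))
      (b' := fun r : ℝ => B * r ^ (-(1 / 2) : ℝ)) hε1
      (fun r hr => (hasDerivAt_pressure heq i
        (hε.trans_le hr.1)).continuousAt.continuousWithinAt)
      (fun r hr => (hb r (hε.trans_le hr.1)).continuousAt.continuousWithinAt)
      (fun r hr => hasDerivAt_pressure heq i (hε.trans hr.1))
      (fun r hr => hb r (hε.trans hr.1)) (fun r hr => hd r (hε.trans hr.1))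
  have h4 : 0 ≤ 2 * B * ε ^ (1 / 2 : ℝ) := by positivity
  have h6 := abs_sub_abs_le_abs_sub (∫ z, D i θ z * heat ε z) (∫ z, D i θ z * heat 1 z)
  rw [abs_sub_comm] at h6
  simp only [Real.one_rpow, mul_one] at h2
  linarith

/-! ### A singular Gronwall inequality -/

/-- The weight `e^{λℓ} (μ + η ℓ^{-α})`. -/
noncomputable def weight (α lam μ η ℓ : ℝ) : ℝ := Real.exp (lam * ℓ) * (μ + η * ℓ ^ (-α))

lemma exp_neg_le_rpow {x θ : ℝ} (hx : 0 < x) (h0 : 0 ≤ θ) (h1 : θ ≤ 1) :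
    Real.exp (-x) ≤ x ^ (-θ) := by
  rw [Real.exp_neg, Real.rpow_neg hx.le]
  have h2 : x ^ θ ≤ Real.exp x := by
    rcases le_total x 1 with h | h
    · exact (Real.rpow_le_one hx.le h h0).trans (Real.one_le_exp hx.le)
    · calc x ^ θ ≤ x ^ (1 : ℝ) := Real.rpow_le_rpow_of_exponent_le h h1
        _ = x := Real.rpow_one x
        _ ≤ Real.exp x := by linarith [Real.add_one_le_exp x]
  exact inv_anti₀ (by positivity) h2

lemma rpow_neg_mul_rpow_neg_le {x y ℓ α β : ℝ} (hx : 0 < x) (hy : 0 < y) (hxy : x + y = ℓ)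
    (hα : 0 ≤ α) (hβ : 0 ≤ β) :
    x ^ (-β) * y ^ (-α) ≤ (ℓ / 2) ^ (-β) * y ^ (-α) + (ℓ / 2) ^ (-α) * x ^ (-β) := by
  have hl : 0 < ℓ / 2 := by linarith
  rcases le_total (ℓ / 2) x with h | h
  · have h1 : x ^ (-β) ≤ (ℓ / 2) ^ (-β) := Real.rpow_le_rpow_of_nonpos hl h (by linarith)
    have h2 : 0 ≤ (ℓ / 2) ^ (-α) * x ^ (-β) := by positivity
    have h3 : x ^ (-β) * y ^ (-α) ≤ (ℓ / 2) ^ (-β) * y ^ (-α) := by gcongr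
    linarith
  · have h1 : y ^ (-α) ≤ (ℓ / 2) ^ (-α) :=
      Real.rpow_le_rpow_of_nonpos hl (by linarith) (by linarith)
    have h2 : 0 ≤ (ℓ / 2) ^ (-β) * y ^ (-α) := by positivity
    have h3 : x ^ (-β) * y ^ (-α) ≤ x ^ (-β) * (ℓ / 2) ^ (-α) := by gcongr
    linarith

/-- Integrating a singular kernel against the weight gains smallness for large `lam`. -/
lemma exists_weight_growth {α : ℝ} (hα : 0 ≤ α) (hα' : α < 1 / 2) {ε : ℝ} (hε : 0 < ε) :
    ∃ lam : ℝ, 0 < lam ∧ ∀ (a t μ η M : ℝ) (F F' : ℝ → ℝ), a < t → t ≤ a + 1 → 0 ≤ μ → 0 ≤ η →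
      0 ≤ M → ContinuousOn F (Icc a t) → (∀ r ∈ Ioo a t, HasDerivAt F (F' r) r) →
      (∀ r ∈ Ioo a t, |F' r| ≤ M * (t - r) ^ (-(1 / 2) - α) * weight α lam μ η (r - a)) →
      |F t - F a| ≤ ε * M * weight α lam μ η (t - a) := by
  set θ : ℝ := (1 / 2 - α) / 2 with hθ
  have hθ0 : 0 < θ := by linarith
  set β : ℝ := 1 / 2 + α + θ with hβ
  have hβ1 : β < 1 := by linarith
  have hβ0 : 0 < β := by linarith
  have hlim : Tendsto (fun lam : ℝ => lam ^ (-θ) * (4 / (1 - β))) atTop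
      (𝓝 (0 * (4 / (1 - β)))) := (tendsto_rpow_neg_atTop hθ0).mul_const _
  rw [zero_mul] at hlim
  obtain ⟨lam, hlam1, hlam0⟩ := ((hlim.eventually (gt_mem_nhds hε)).and
    (eventually_gt_atTop 0)).exists
  refine ⟨lam, hlam0, ?_⟩
  intro a t μ η M F F' hat hta hμ hη hM hF hF' hbd
  set ℓ := t - a with hℓ
  have hℓ0 : 0 < ℓ := by linarith
  have hℓ1 : ℓ ≤ 1 := by linarith
  set K : ℝ := M * (Real.exp (lam * ℓ) * lam ^ (-θ)) with hK
  have hK0 : 0 ≤ K := by positivity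
  set b : ℝ → ℝ := fun r => K * (-(μ / (1 - β)) * (t - r) ^ (1 - β) +
    η * ((ℓ / 2) ^ (-β) * ((r - a) ^ (1 - α) / (1 - α)) -
      (ℓ / 2) ^ (-α) * ((t - r) ^ (1 - β) / (1 - β)))) with hb
  have hbc : ContinuousOn b (Icc a t) := by
    have h1 : Continuous fun r : ℝ => (t - r) ^ (1 - β) :=
      (Real.continuous_rpow_const (by linarith)).comp (by fun_prop)
    have h2 : Continuous fun r : ℝ => (r - a) ^ (1 - α) :=
      (Real.continuous_rpow_const (by linarith)).comp (by fun_prop)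
    rw [hb]
    exact Continuous.continuousOn (by fun_prop)
  have hb' : ∀ r ∈ Ioo a t, HasDerivAt b (K * (μ * (t - r) ^ (-β) +
      η * ((ℓ / 2) ^ (-β) * (r - a) ^ (-α) + (ℓ / 2) ^ (-α) * (t - r) ^ (-β)))) r := by
    intro r hr
    have h1 : HasDerivAt (fun r : ℝ => (t - r) ^ (1 - β)) (-((1 - β) * (t - r) ^ (-β))) r := by
      have := ((hasDerivAt_id r).const_sub t).rpow_const (p := 1 - β) (Or.inl (by
        simp only [id]; linarith [hr.2]))
      refine this.congr_deriv ?_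
      simp only [id_eq]
      rw [show 1 - β - 1 = -β by ring]; ring
    have h2 : HasDerivAt (fun r : ℝ => (r - a) ^ (1 - α)) ((1 - α) * (r - a) ^ (-α)) r := by
      have := ((hasDerivAt_id r).sub_const a).rpow_const (p := 1 - α) (Or.inl (by
        simp only [id]; linarith [hr.1]))
      refine this.congr_deriv ?_
      simp only [id_eq]
      rw [show 1 - α - 1 = -α by ring]; ring
    have h3 := ((h1.const_mul (-(μ / (1 - β)))).add
      ((((h2.div_const (1 - α)).const_mul ((ℓ / 2) ^ (-β))).sub
        ((h1.div_const (1 - β)).const_mul ((ℓ / 2) ^ (-α)))).const_mul η)).const_mul K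
    refine h3.congr_deriv ?_
    have : 1 - β ≠ 0 := by linarith
    have : 1 - α ≠ 0 := by linarith
    field_simp
    ring
  have hmain := abs_sub_le_of_deriv_le hat.le hF hbc hF' hb' fun r hr => by
    have hx : 0 < t - r := by linarith [hr.2]
    have hy : 0 < r - a := by linarith [hr.1]
    refine (hbd r hr).trans ?_
    have h1 : Real.exp (lam * (r - a)) ≤ Real.exp (lam * ℓ) * (lam ^ (-θ) * (t - r) ^ (-θ)) := by
      rw [← Real.mul_rpow hlam0.le hx.le,
        show lam * (r - a) = lam * ℓ + -(lam * (t - r)) by rw [hℓ]; ring, Real.exp_add]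
      gcongr
      exact exp_neg_le_rpow (by positivity) hθ0.le (by linarith)
    have h2 : (t - r) ^ (-(1 / 2) - α) * (t - r) ^ (-θ) = (t - r) ^ (-β) := by
      rw [← Real.rpow_add hx]; congr 1; rw [hβ]; ring
    have h3 := rpow_neg_mul_rpow_neg_le hx hy (show t - r + (r - a) = ℓ by rw [hℓ]; ring)
      hα hβ0.le
    calc M * (t - r) ^ (-(1 / 2) - α) * weight α lam μ η (r - a)
        ≤ M * (t - r) ^ (-(1 / 2) - α) * (Real.exp (lam * ℓ) * (lam ^ (-θ) * (t - r) ^ (-θ)) *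
          (μ + η * (r - a) ^ (-α))) := by
          unfold weight; gcongr
      _ = K * (μ * ((t - r) ^ (-(1 / 2) - α) * (t - r) ^ (-θ)) +
          η * ((t - r) ^ (-(1 / 2) - α) * (t - r) ^ (-θ) * (r - a) ^ (-α))) := by
          rw [hK]; ring
      _ ≤ _ := by
          rw [h2]; gcongr
  refine hmain.trans ?_
  have e1 : b t - b a = K * (μ * ℓ ^ (1 - β) / (1 - β) +
      η * ((ℓ / 2) ^ (-β) * (ℓ ^ (1 - α) / (1 - α)) + (ℓ / 2) ^ (-α) * (ℓ ^ (1 - β) / (1 - β)))) := by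
    simp only [hb, sub_self, ← hℓ]
    rw [Real.zero_rpow (by linarith), Real.zero_rpow (by linarith)]
    ring
  have hle1 : ∀ x : ℝ, 0 ≤ x → ℓ ^ x ≤ 1 := fun x hx => Real.rpow_le_one hℓ0.le hℓ1 hx
  have hp : ∀ x y : ℝ, 0 ≤ x → x ≤ 1 → x + y = α + β → (ℓ / 2) ^ (-x) * ℓ ^ (1 - y) ≤
      2 * ℓ ^ (-α) := by
    intro x y hx hx1 hxy
    rw [Real.div_rpow hℓ0.le (by norm_num), Real.rpow_neg (by norm_num : (0:ℝ) ≤ 2),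
      div_inv_eq_mul, mul_right_comm, ← Real.rpow_add hℓ0,
      show -x + (1 - y) = -α + (1 - β) by linarith, Real.rpow_add hℓ0]
    have h1 := hle1 (1 - β) (by linarith)
    have h2 : (2 : ℝ) ^ x ≤ 2 := by
      calc (2 : ℝ) ^ x ≤ 2 ^ (1 : ℝ) := Real.rpow_le_rpow_of_exponent_le (by norm_num) hx1
        _ = 2 := Real.rpow_one 2
    have h3 : 0 < ℓ ^ (-α) := by positivity
    have h4 : 0 < ℓ ^ (1 - β) := by positivity
    calc ℓ ^ (-α) * ℓ ^ (1 - β) * 2 ^ x ≤ ℓ ^ (-α) * 1 * 2 := by gcongr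
      _ = 2 * ℓ ^ (-α) := by ring
  have q1 := hp β α hβ0.le hβ1.le (by ring)
  have q2 := hp α β hα (by linarith) rfl
  have q3 := hle1 (1 - β) (by linarith)
  have hb1 : 0 < 1 - β := by linarith
  have hα1 : (1 : ℝ) / (1 - α) ≤ 1 / (1 - β) := by
    apply one_div_le_one_div_of_le hb1; linarith
  have hℓα : 0 < ℓ ^ (-α) := by positivity
  calc b t - b a = K * (μ * ℓ ^ (1 - β) * (1 / (1 - β)) +
      η * ((ℓ / 2) ^ (-β) * ℓ ^ (1 - α) * (1 / (1 - α)) +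
        (ℓ / 2) ^ (-α) * ℓ ^ (1 - β) * (1 / (1 - β)))) := by rw [e1]; ring
    _ ≤ K * (μ * 1 * (1 / (1 - β)) +
      η * (2 * ℓ ^ (-α) * (1 / (1 - β)) + 2 * ℓ ^ (-α) * (1 / (1 - β)))) := by
        have : 0 ≤ 1 / (1 - α) := one_div_nonneg.2 (by linarith)
        have : 0 ≤ 1 / (1 - β) := one_div_nonneg.2 (by linarith)
        gcongr
    _ ≤ K * (4 / (1 - β) * (μ + η * ℓ ^ (-α))) := by
        have : 0 ≤ μ * (1 / (1 - β)) := mul_nonneg hμ (one_div_nonneg.2 hb1.le)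
        refine mul_le_mul_of_nonneg_left ?_ hK0
        calc _ = μ * (1 / (1 - β)) + 4 / (1 - β) * (η * ℓ ^ (-α)) := by ring
          _ ≤ 4 * (μ * (1 / (1 - β))) + 4 / (1 - β) * (η * ℓ ^ (-α)) := by linarith
          _ = _ := by ring
    _ = (lam ^ (-θ) * (4 / (1 - β))) * M * weight α lam μ η ℓ := by
        rw [hK, weight]; ring
    _ ≤ ε * M * weight α lam μ η ℓ := by
        have : 0 ≤ weight α lam μ η ℓ := by unfold weight; positivity
        gcongr

lemma le_of_contraction {ι : Type*} {g : ι → ℝ} {A S₀ : ℝ} (h₀ : ∀ x, g x ≤ S₀)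
    (h : ∀ S, 0 ≤ S → (∀ x, g x ≤ S) → ∀ x, g x ≤ A + S / 2) (hA : 0 ≤ A) (x : ι) :
    g x ≤ 2 * A := by
  have key : ∀ n : ℕ, ∀ x, g x ≤ 2 * A + |S₀| / 2 ^ n := by
    intro n
    induction n with
    | zero => intro x; simpa using (h₀ x).trans ((le_abs_self _).trans (by linarith))
    | succ n ih =>
      intro x
      refine (h _ (by positivity) ih x).trans (le_of_eq ?_)
      rw [pow_succ]; field_simp; ring
  have hlim : Tendsto (fun n : ℕ => 2 * A + |S₀| / 2 ^ n) atTop (𝓝 (2 * A + 0)) := by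
    refine Tendsto.const_add _ ?_
    exact tendsto_const_nhds.div_atTop (tendsto_pow_atTop_atTop_of_one_lt (by norm_num))
  rw [add_zero] at hlim
  exact ge_of_tendsto hlim (Eventually.of_forall fun n => key n x)

/-! ### Pointwise limits of divergence-free fields -/

/-- A pointwise limit of divergence-free Schwartz fields that is itself a Schwartz field is
divergence-free. The boundedness needed to pass to the limit holds on a dense open set. -/
lemma div_eq_zero_of_tendsto {f : ℕ → Fin N → Sch N} {g : Fin N → Sch N}
    (hfg : ∀ k x, Tendsto (fun m => f m k x) atTop (𝓝 (g k x)))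
    (hf : ∀ m, ∑ k, D k (f m k) = 0) : ∑ k, D k (g k) = 0 := by
  set G : Sch N := ∑ k, D k (g k) with hG
  set X : ℕ → Set (Fin N → ℝ) := fun n => {x | ∀ m k, |f m k x| ≤ n} with hX
  have hXc : ∀ n, IsClosed (X n) := by
    intro n
    simp only [hX, ofPred_forall]
    exact isClosed_iInter fun m => isClosed_iInter fun k =>
      isClosed_le (f m k).continuous.abs continuous_const
  have hXu : ⋃ n, X n = univ := by
    refine eq_univ_of_forall fun x => ?_
    have hb : ∀ k, ∃ c, ∀ m, |f m k x| ≤ c := fun k => by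
      obtain ⟨c, hc⟩ := (hfg k x).abs.bddAbove_range
      exact ⟨c, fun m => hc ⟨m, rfl⟩⟩
    choose c hc using hb
    obtain ⟨n, hn⟩ := exists_nat_ge (∑ k, |c k|)
    refine mem_iUnion.2 ⟨n, fun m k => ((hc k m).trans (le_abs_self _)).trans (le_trans ?_ hn)⟩
    exact Finset.single_le_sum (f := fun k => |c k|) (fun _ _ => abs_nonneg _) (Finset.mem_univ k)
  have hdense := dense_iUnion_interior_of_closed hXc hXu
  have hzero : ∀ n, ∀ x ∈ interior (X n), G x = 0 := by
    intro n
    have hO : IsOpen (interior (X n)) := isOpen_interior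
    have hae : ∀ᵐ x, x ∈ interior (X n) → G x = 0 := by
      refine hO.ae_eq_zero_of_integral_contDiff_smul_eq_zero
        (G.continuous.locallyIntegrable.locallyIntegrableOn _) fun φ hφ hφc hφs => ?_
      set Φ : Sch N := hφc.toSchwartzMap hφ with hΦ
      have hΦφ : ∀ x, Φ x = φ x := fun x => rfl
      have hparts : ∀ h : Fin N → Sch N, ∫ x, φ x • (∑ k, D k (h k)) x =
          -∑ k, ∫ x, h k x * D k Φ x := by
        intro h
        have : ∀ x, φ x • (∑ k, D k (h k)) x = ∑ k, D k (h k) x * Φ x := fun x => by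
          rw [sum_apply, smul_eq_mul, ← hΦφ, mul_comm, Finset.sum_mul]
        simp_rw [this]
        rw [integral_finsetSum _ fun k _ => integrable_mul _ Φ.integrable, ← Finset.sum_neg_distrib]
        exact Finset.sum_congr rfl fun k _ => integral_D_mul k (h k) Φ.integrable
          (D k Φ).integrable (hasLineDerivAt_D k Φ)
      have hDΦ : ∀ k, ∀ x ∉ interior (X n), D k Φ x = 0 := by
        intro k x hx
        have h1 : x ∉ tsupport (Φ : (Fin N → ℝ) → ℝ) := fun h => hx (hφs h)
        rw [D_eq_fderiv, fderiv_of_notMem_tsupport ℝ h1]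
        rfl
      have hlim : Tendsto (fun m => ∑ k, ∫ x, f m k x * D k Φ x) atTop
          (𝓝 (∑ k, ∫ x, g k x * D k Φ x)) := by
        refine tendsto_finsetSum _ fun k _ => ?_
        refine tendsto_integral_of_dominated_convergence (fun x => n * |D k Φ x|)
          (fun m => ((f m k).continuous.mul (D k Φ).continuous).aestronglyMeasurable)
          ((D k Φ).integrable.abs.const_mul _) (fun m => Eventually.of_forall fun x => ?_)
          (Eventually.of_forall fun x => (hfg k x).mul_const _)
        by_cases hx : x ∈ interior (X n)
        · rw [Real.norm_eq_abs, abs_mul]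
          exact mul_le_mul_of_nonneg_right (interior_subset hx m k) (abs_nonneg _)
        · simp [hDΦ k x hx]
      have hm : ∀ m, ∑ k, ∫ x, f m k x * D k Φ x = 0 := fun m => by
        have := hparts (f m)
        rw [hf m] at this
        simp only [zero_apply, smul_zero, integral_zero] at this
        linarith
      simp_rw [hm] at hlim
      rw [hparts g, tendsto_nhds_unique hlim tendsto_const_nhds, neg_zero]
    have h2 : (G : (Fin N → ℝ) → ℝ) =ᵐ[volume.restrict (interior (X n))] fun _ => 0 :=
      (ae_restrict_iff' hO.measurableSet).2 hae
    exact Measure.eqOn_open_of_ae_eq h2 hO G.continuous.continuousOn continuousOn_const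
  have : (G : (Fin N → ℝ) → ℝ) = fun _ => 0 :=
    Continuous.ext_on hdense G.continuous continuous_const fun x hx => by
      obtain ⟨n, hn⟩ := mem_iUnion.1 hx
      exact hzero n x hn
  ext x
  exact congrFun this x

/-! ### Solutions with values in Schwartz space -/

/-- The time interval `[0, T)`. -/
def dom (T : ℝ≥0∞) : Set ℝ := {t | 0 ≤ t ∧ ENNReal.ofReal t < T}

lemma ordConnected_dom (T : ℝ≥0∞) : (dom T).OrdConnected :=
  ⟨fun _ hx _ hy _ hz => ⟨hx.1.trans hz.1, (ENNReal.ofReal_le_ofReal hz.2).trans_lt hy.2⟩⟩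

lemma dom_mem_nhds {T : ℝ≥0∞} {t : ℝ} (ht : t ∈ dom T) (h0 : 0 < t) : dom T ∈ 𝓝 t := by
  have h1 : ∀ᶠ r in 𝓝 t, ENNReal.ofReal r < T :=
    ENNReal.continuous_ofReal.continuousAt.eventually (gt_mem_nhds ht.2)
  filter_upwards [h1, lt_mem_nhds h0] with r hr hr0
  exact ⟨hr0.le, hr⟩

/-- The time derivative of the velocity prescribed by the Navier–Stokes equations. -/
noncomputable def rhs (w : Fin N → Sch N) (q : Sch N) (i : Fin N) : Sch N :=
  ∑ j, D j (D j (w i)) - ∑ j, mulS (w j) (D j (w i)) - D i q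

/-- A solution of the Navier–Stokes equations with values in Schwartz space, bounded in `L^p`. -/
structure IsSol (p A : ℝ) (T : ℝ≥0∞) (u : ℝ → Fin N → Sch N) (Q : ℝ → Sch N) : Prop where
  cont : ∀ i x, ContinuousOn (fun r => u r i x) (dom T)
  deriv : ∀ t ∈ dom T, 0 < t → ∀ i x, HasDerivAt (fun r => u r i x) (rhs (u t) (Q t) i x) t
  div : ∀ t ∈ dom T, ∑ k, D k (u t k) = 0
  lp : ∀ t ∈ dom T, ∀ i, ∫ x, |u t i x| ^ p ≤ A

variable {p A : ℝ} {T : ℝ≥0∞} {u : ℝ → Fin N → Sch N} {Q : ℝ → Sch N}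

lemma IsSol.div_rhs (hs : IsSol p A T u Q) {t : ℝ} (ht : t ∈ dom T) (h0 : 0 < t) :
    ∑ k, D k (rhs (u t) (Q t) k) = 0 := by
  obtain ⟨δ, hδ, hball⟩ := Metric.mem_nhds_iff.1 (dom_mem_nhds ht h0)
  set e : ℕ → ℝ := fun m => δ / 2 / (m + 1) with he
  have he0 : ∀ m, 0 < e m := fun m => by positivity
  have hed : ∀ m, t + e m ∈ dom T := fun m => by
    refine hball ?_
    rw [Metric.mem_ball, Real.dist_eq, add_sub_cancel_left, abs_of_pos (he0 m)]
    have : e m ≤ δ / 2 := div_le_self (by positivity) (by linarith [Nat.cast_nonneg (α := ℝ) m])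
    linarith
  have hlim : Tendsto e atTop (𝓝[≠] 0) := by
    refine tendsto_nhdsWithin_iff.2 ⟨?_, Eventually.of_forall fun m => (he0 m).ne'⟩
    exact tendsto_const_nhds.div_atTop
      (tendsto_atTop_add_const_right _ _ tendsto_natCast_atTop_atTop)
  refine div_eq_zero_of_tendsto (f := fun m k => (e m)⁻¹ • (u (t + e m) k - u t k))
    (fun k x => ?_) fun m => ?_
  · have := (hs.deriv t ht h0 k x).tendsto_slope_zero.comp hlim
    simpa [Function.comp_def] using this
  · simp only [map_smul, map_sub, ← Finset.smul_sum, Finset.sum_sub_distrib]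
    rw [hs.div _ (hed m), hs.div t ht, sub_zero, smul_zero]

lemma sum_mulS_D_eq {w : Fin N → Sch N} (hw : ∑ k, D k (w k) = 0) (f : Sch N) :
    ∑ j, mulS (w j) (D j f) = ∑ j, D j (mulS (w j) f) := by
  simp_rw [D_mul, Finset.sum_add_distrib]
  have : ∑ j, mulS (D j (w j)) f = 0 := by
    ext x
    have h := DFunLike.congr_fun hw x
    rw [sum_apply, zero_apply] at h
    rw [sum_apply]
    simp only [mulS_apply, ← Finset.sum_mul, h, zero_mul, zero_apply]
  rw [this, zero_add]

lemma rhs_eq {w : Fin N → Sch N} (hw : ∑ k, D k (w k) = 0) (q : Sch N) (i : Fin N) :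
    rhs w q i = ∑ j, D j (D j (w i)) - (∑ j, D j (mulS (w j) (w i)) + D i q) := by
  rw [rhs, sum_mulS_D_eq hw, sub_sub]

/-- The pressure equation. -/
lemma IsSol.pressure (hs : IsSol p A T u Q) {t : ℝ} (ht : t ∈ dom T) (h0 : 0 < t) :
    ∑ j, D j (D j (Q t)) = -∑ j, ∑ k, D j (D k (mulS (u t j) (u t k))) := by
  have h := hs.div_rhs ht h0
  simp_rw [rhs_eq (hs.div t ht), map_sub, map_add, map_sum, Finset.sum_sub_distrib,
    Finset.sum_add_distrib] at h
  have h1 : ∑ k, ∑ j, D k (D j (D j (u t k))) = 0 := by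
    rw [Finset.sum_comm]
    have : ∀ j, ∑ k, D k (D j (D j (u t k))) = D j (D j (∑ k, D k (u t k))) := fun j => by
      simp only [map_sum]
      exact Finset.sum_congr rfl fun k _ => by rw [D_comm k j, D_comm k j]
    simp_rw [this, hs.div t ht, map_zero, Finset.sum_const_zero]
  rw [h1, zero_sub, neg_eq_zero] at h
  rw [eq_neg_of_add_eq_zero_right h, Finset.sum_comm]
  congr 1
  exact Finset.sum_congr rfl fun j _ => Finset.sum_congr rfl fun k _ => D_comm _ _ _

/-! ### Continuity in time of heat averages -/

/-- Truncation to `[-R, R]`. -/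
noncomputable def trunc (R y : ℝ) : ℝ := max (-R) (min y R)

@[fun_prop]
lemma continuous_trunc (R : ℝ) : Continuous (trunc R) := by unfold trunc; fun_prop

lemma abs_trunc_le {R : ℝ} (hR : 0 ≤ R) (y : ℝ) : |trunc R y| ≤ R := by
  rw [abs_le]
  exact ⟨le_max_left _ _, max_le (by linarith) (min_le_right _ _)⟩

lemma abs_sub_trunc_le {R p : ℝ} (hR : 0 < R) (hp : 2 ≤ p) (y : ℝ) :
    |y - trunc R y| ≤ (1 + |y| ^ p) / R := by
  have hpos : 0 ≤ |y| ^ p := by positivity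
  have h1 : y ^ 2 ≤ 1 + |y| ^ p := by
    rw [← sq_abs]
    rcases le_total |y| 1 with h | h
    · nlinarith [abs_nonneg y]
    · have : |y| ^ (2 : ℝ) ≤ |y| ^ p := Real.rpow_le_rpow_of_exponent_le h hp
      rw [Real.rpow_two] at this
      linarith
  have h2 : |y - trunc R y| * R ≤ y ^ 2 := by
    unfold trunc
    rcases le_total y (-R) with h | h
    · rw [min_eq_left (by linarith), max_eq_left h, abs_of_nonpos (by linarith)]
      nlinarith
    · rcases le_total y R with h' | h'
      · rw [min_eq_left h', max_eq_right h, sub_self, abs_zero, zero_mul]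
        positivity
      · rw [min_eq_right h', max_eq_right (by linarith), abs_of_nonneg (by linarith)]
        nlinarith
  rw [le_div_iff₀ hR]
  linarith

lemma continuousOn_integral_heat {f : ℝ → Sch N} {S : Set ℝ} {p A σ : ℝ} (hp : 2 ≤ p)
    (hf : ∀ x, ContinuousOn (fun r => f r x) S) (hA : ∀ r ∈ S, ∫ x, |f r x| ^ p ≤ A) :
    ContinuousOn (fun r => ∫ z, f r z * heat (σ - r) z) (S ∩ Iio σ) := by
  intro r₀ hr₀
  obtain ⟨d, hd⟩ : ∃ d, d = σ - r₀ := ⟨_, rfl⟩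
  have hd0 : 0 < d := by have := hr₀.2; rw [mem_Iio] at this; linarith
  have hA0 : 0 ≤ A := (integral_nonneg fun x => by positivity).trans (hA r₀ hr₀.1)
  have hsr : ∀ r ∈ Metric.ball r₀ (d / 2), d / 2 < σ - r ∧ σ - r < 3 / 2 * d := by
    intro r hr
    rw [Metric.mem_ball, Real.dist_eq, abs_lt] at hr
    constructor <;> linarith [hr.1, hr.2]
  have hmem : Metric.ball r₀ (d / 2) ∩ (S ∩ Iio σ) ∈ 𝓝[S ∩ Iio σ] r₀ :=
    inter_mem (mem_nhdsWithin_of_mem_nhds (Metric.ball_mem_nhds _ (by positivity)))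
      self_mem_nhdsWithin
  refine continuousWithinAt_of_locally_uniform_approx_of_continuousWithinAt hr₀ fun V hV => ?_
  obtain ⟨ε, hε, hεV⟩ := Metric.mem_uniformity_dist.1 hV
  set c : ℝ := 1 + A * (d / 2) ^ (-(N : ℝ) / 2) with hc
  have hc0 : 0 < c := by positivity
  obtain ⟨R, hR⟩ : ∃ R, R = 2 * c / ε := ⟨_, rfl⟩
  have hR0 : 0 < R := by rw [hR]; positivity
  refine ⟨_, hmem, fun r => ∫ z, trunc R (f r z) * heat (σ - r) z, ?_, ?_⟩
  · refine continuousWithinAt_of_dominated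
      (bound := fun z => R * ((6 : ℝ) ^ ((N : ℝ) / 2) * heat (3 * d) z)) ?_ ?_ ?_ ?_
    · refine Eventually.of_forall fun r => Continuous.aestronglyMeasurable ?_
      have := (f r).continuous
      fun_prop
    · filter_upwards [hmem] with r hr
      obtain ⟨h1, h2⟩ := hsr r hr.1
      refine Eventually.of_forall fun z => ?_
      have h3 := heat_pos (show 0 < σ - r by linarith) z
      rw [Real.norm_eq_abs, abs_mul, abs_of_pos h3]
      exact mul_le_mul (abs_trunc_le hR0.le _) (heat_le_of_mem hd0 h1 (by linarith) z) h3.le hR0.le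
    · exact ((integrable_heat (by positivity)).const_mul _).const_mul _
    · refine Eventually.of_forall fun z => ContinuousWithinAt.mul ?_ ?_
      · exact (continuous_trunc R).continuousAt.comp_continuousWithinAt
          ((hf z r₀ hr₀.1).mono inter_subset_left)
      · have h1 : ContinuousAt (fun s => heat s z) (σ - r₀) :=
          (hasDerivAt_heat (by linarith) z).continuousAt
        have h2 : ContinuousAt (fun r : ℝ => σ - r) r₀ := by fun_prop
        exact (ContinuousAt.comp (f := fun r : ℝ => σ - r) h1 h2).continuousWithinAt
  · intro r hr
    apply hεV
    obtain ⟨h1, h2⟩ := hsr r hr.1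
    have h3 : 0 < σ - r := by linarith
    have hi1 := integrable_mul (f r) (integrable_heat h3)
    have hi2 : Integrable fun z => trunc R (f r z) * heat (σ - r) z :=
      integrable_mul_of_bounded (integrable_heat h3)
        ((continuous_trunc R).comp (f r).continuous) fun x => abs_trunc_le hR0.le _
    rw [Real.dist_eq, ← integral_sub hi1 hi2]
    have hb : Integrable fun z => (1 / R) * (heat (σ - r) z +
        (d / 2) ^ (-(N : ℝ) / 2) * |f r z| ^ p) :=
      ((integrable_heat h3).add
        ((integrable_abs_rpow (f r) (by linarith)).const_mul _)).const_mul _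
    have hle : |∫ z, (f r z * heat (σ - r) z - trunc R (f r z) * heat (σ - r) z)| ≤
        ∫ z, (1 / R) * (heat (σ - r) z + (d / 2) ^ (-(N : ℝ) / 2) * |f r z| ^ p) := by
      refine norm_integral_le_of_norm_le
        (f := fun z => f r z * heat (σ - r) z - trunc R (f r z) * heat (σ - r) z) hb
        (Eventually.of_forall fun z => ?_)
      have h4 := heat_pos h3 z
      have h5 := abs_sub_trunc_le hR0 hp (f r z)
      have h6 : heat (σ - r) z ≤ (d / 2) ^ (-(N : ℝ) / 2) :=
        (heat_le_sup h3 z).trans (Real.rpow_le_rpow_of_nonpos (by positivity) h1.le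
          (by have : (0 : ℝ) ≤ N := by positivity
              linarith))
      rw [← sub_mul, Real.norm_eq_abs, abs_mul, abs_of_pos h4]
      calc |f r z - trunc R (f r z)| * heat (σ - r) z
          ≤ (1 + |f r z| ^ p) / R * heat (σ - r) z := by gcongr
        _ = (1 / R) * (heat (σ - r) z + heat (σ - r) z * |f r z| ^ p) := by ring
        _ ≤ _ := by gcongr
    refine hle.trans_lt ?_
    rw [integral_const_mul, integral_add (integrable_heat h3)
      ((integrable_abs_rpow (f r) (by linarith)).const_mul _), integral_heat h3,
      integral_const_mul]
    have h7 : 1 + (d / 2) ^ (-(N : ℝ) / 2) * ∫ z, |f r z| ^ p ≤ c := by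
      rw [hc, mul_comm A]
      gcongr
      exact hA r hr.2.1
    calc 1 / R * (1 + (d / 2) ^ (-(N : ℝ) / 2) * ∫ z, |f r z| ^ p) ≤ 1 / R * c := by gcongr
      _ = ε / 2 := by rw [hR]; field_simp
      _ < ε := by linarith

/-! ### Combinations of translations -/

/-- Finite linear combinations of translations. -/
inductive IsComb : (Sch N →L[ℝ] Sch N) → Prop
  | one : IsComb (ContinuousLinearMap.id ℝ _)
  | trans_comp (a : Fin N → ℝ) {L : Sch N →L[ℝ] Sch N} : IsComb L → IsComb ((trans a).comp L)
  | sub {L L' : Sch N →L[ℝ] Sch N} : IsComb L → IsComb L' → IsComb (L - L')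

lemma IsComb.dif_comp {L : Sch N →L[ℝ] Sch N} (hL : IsComb L) (h : Fin N → ℝ) :
    IsComb ((dif h).comp L) := by
  have : (dif h).comp L = (trans h).comp L - L := by ext f x; simp
  rw [this]
  exact (hL.trans_comp h).sub hL

lemma IsComb.D_comm {L : Sch N →L[ℝ] Sch N} (hL : IsComb L) (j : Fin N) (f : Sch N) :
    D j (L f) = L (D j f) := by
  induction hL with
  | one => rfl
  | trans_comp a _ ih => simp [D_trans, ih]
  | sub _ _ ih ih' => simp [ih, ih']

lemma IsComb.exists_bound {L : Sch N →L[ℝ] Sch N} (hL : IsComb L) :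
    ∃ C, 0 ≤ C ∧ ∀ (f : Sch N) M, (∀ x, |f x| ≤ M) → ∀ x, |L f x| ≤ C * M := by
  induction hL with
  | one => exact ⟨1, zero_le_one, fun f M h x => by simpa using h x⟩
  | trans_comp a _ ih =>
    obtain ⟨C, h0, hC⟩ := ih
    exact ⟨C, h0, fun f M h x => by simpa using hC f M h (x + a)⟩
  | sub _ _ ih ih' =>
    obtain ⟨C, h0, hC⟩ := ih
    obtain ⟨C', h0', hC'⟩ := ih'
    refine ⟨C + C', by positivity, fun f M h x => ?_⟩
    simp only [sub_apply]
    exact (abs_sub _ _).trans (by linarith [hC f M h x, hC' f M h x])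

lemma IsComb.hasDerivAt {L : Sch N →L[ℝ] Sch N} (hL : IsComb L) {f : ℝ → Sch N} {g : Sch N}
    {t : ℝ} (h : ∀ x, HasDerivAt (fun r => f r x) (g x) t) (x : Fin N → ℝ) :
    HasDerivAt (fun r => L (f r) x) (L g x) t := by
  induction hL generalizing x with
  | one => exact h x
  | trans_comp a _ ih => simpa using ih (x + a)
  | sub _ _ ih ih' => exact (ih x).fun_sub (ih' x)

lemma IsComb.continuousOn {L : Sch N →L[ℝ] Sch N} (hL : IsComb L) {f : ℝ → Sch N}
    {S : Set ℝ} (h : ∀ x, ContinuousOn (fun r => f r x) S) (x : Fin N → ℝ) :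
    ContinuousOn (fun r => L (f r) x) S := by
  induction hL generalizing x with
  | one => exact h x
  | trans_comp a _ ih => simpa using ih (x + a)
  | sub _ _ ih ih' => exact (ih x).fun_sub (ih' x)

lemma IsComb.continuousOn_integral_heat {L : Sch N →L[ℝ] Sch N} (hL : IsComb L)
    {f : ℝ → Sch N} {S : Set ℝ} {p A σ : ℝ} (hp : 2 ≤ p)
    (hf : ∀ x, ContinuousOn (fun r => f r x) S) (hA : ∀ r ∈ S, ∫ x, |f r x| ^ p ≤ A) :
    ContinuousOn (fun r => ∫ z, L (f r) z * heat (σ - r) z) (S ∩ Iio σ) := by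
  have key : ∀ b : Fin N → ℝ,
      ContinuousOn (fun r => ∫ z, trans b (L (f r)) z * heat (σ - r) z) (S ∩ Iio σ) := by
    induction hL with
    | one =>
      intro b
      refine NavierStokes.continuousOn_integral_heat (f := fun r => trans b (f r)) (A := A) hp
        (fun x => by simpa using hf (x + b)) fun r hr => ?_
      simp only [trans_apply]
      rw [integral_add_right_eq_self (fun x => |f r x| ^ p) b]
      exact hA r hr
    | trans_comp a _ ih =>
      intro b
      refine (ih (b + a)).congr fun r _ => integral_congr_ae (Eventually.of_forall fun z => ?_)
      simp [add_assoc]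
    | sub _ _ ih ih' =>
      intro b
      refine ((ih b).sub (ih' b)).congr fun r hr => ?_
      have hr : 0 < σ - r := sub_pos.2 hr.2
      simp only [Pi.sub_apply]
      rw [← integral_sub (integrable_mul _ (integrable_heat hr))
        (integrable_mul _ (integrable_heat hr))]
      exact integral_congr_ae (Eventually.of_forall fun z => by simp [sub_mul])
  simpa using key 0

/-! ### The Duhamel estimate at good times -/

/-- Times near which the velocity and its time derivative are uniformly bounded. -/
def good (T : ℝ≥0∞) (u : ℝ → Fin N → Sch N) (Q : ℝ → Sch N) : Set ℝ :=
  {t | ∃ ε > 0, ∃ C, ∀ r ∈ Metric.ball t ε, r ∈ dom T ∧ 0 < r ∧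
    ∀ i x, |u r i x| ≤ C ∧ |rhs (u r) (Q r) i x| ≤ C}

lemma isOpen_good : IsOpen (good T u Q) := by
  refine Metric.isOpen_iff.2 fun t ht => ?_
  obtain ⟨ε, hε, C, hC⟩ := ht
  refine ⟨ε, hε, fun r hr => ?_⟩
  obtain ⟨δ, hδ, hsub⟩ := Metric.isOpen_iff.1 Metric.isOpen_ball r hr
  exact ⟨δ, hδ, C, fun r' hr' => hC r' (hsub hr')⟩

lemma mem_dom_of_good {t : ℝ} (ht : t ∈ good T u Q) : t ∈ dom T := by
  obtain ⟨ε, hε, C, hC⟩ := ht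
  exact (hC t (Metric.mem_ball_self hε)).1

lemma pos_of_good {t : ℝ} (ht : t ∈ good T u Q) : 0 < t := by
  obtain ⟨ε, hε, C, hC⟩ := ht
  exact (hC t (Metric.mem_ball_self hε)).2.1

/-- The velocity is bounded on compact sets of good times. -/
lemma exists_bound_of_isCompact {K : Set ℝ} (hK : IsCompact K) (hg : K ⊆ good T u Q) :
    ∃ C, 0 ≤ C ∧ ∀ t ∈ K, ∀ i x, |u t i x| ≤ C := by
  refine hK.induction_on (p := fun K => ∃ C, 0 ≤ C ∧ ∀ t ∈ K, ∀ i x, |u t i x| ≤ C) ?_ ?_ ?_ ?_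
  · exact ⟨0, le_rfl, by simp⟩
  · rintro s t hst ⟨C, h0, hC⟩
    exact ⟨C, h0, fun r hr => hC r (hst hr)⟩
  · rintro s t ⟨C, h0, hC⟩ ⟨C', h0', hC'⟩
    refine ⟨max C C', le_max_of_le_left h0, fun r hr i x => ?_⟩
    rcases hr with hr | hr
    · exact (hC r hr i x).trans (le_max_left _ _)
    · exact (hC' r hr i x).trans (le_max_right _ _)
  · intro t ht
    obtain ⟨ε, hε, C, hC⟩ := hg ht
    refine ⟨_, mem_nhdsWithin_of_mem_nhds (Metric.ball_mem_nhds t hε), |C|, abs_nonneg _,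
      fun r hr i x => ((hC r hr).2.2 i x).1.trans (le_abs_self _)⟩

lemma IsSol.comb_pressure (hs : IsSol p A T u Q) {L : Sch N →L[ℝ] Sch N} (hL : IsComb L) {t : ℝ}
    (ht : t ∈ dom T) (h0 : 0 < t) :
    ∑ j, D j (D j (L (Q t))) = -∑ j, ∑ k, D j (D k (L (mulS (u t j) (u t k)))) := by
  have h := congrArg L (hs.pressure ht h0)
  simpa only [map_sum, map_neg, hL.D_comm] using h

lemma IsSol.hasDerivAt_average (hs : IsSol p A T u Q) {L : Sch N →L[ℝ] Sch N} (hL : IsComb L)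
    {r σ : ℝ} (hr : r ∈ good T u Q) (hσ : r < σ) (i : Fin N) :
    HasDerivAt (fun r => ∫ z, L (u r i) z * heat (σ - r) z)
      (-∫ z, (∑ j, D j (L (mulS (u r j) (u r i))) + D i (L (Q r))) z * heat (σ - r) z) r := by
  have hrd := mem_dom_of_good hr
  obtain ⟨ε, hε, C, hC⟩ := hr
  obtain ⟨c, hc0, hc⟩ := hL.exists_bound
  have h := hasDerivAt_integral_heat (f := fun r => L (u r i))
    (f' := fun r => L (rhs (u r) (Q r) i)) (C := c * C) hε hσ
    (fun r hr z => hL.hasDerivAt (hs.deriv r (hC r hr).1 (hC r hr).2.1 i) z)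
    (fun r hr z => hc _ C (fun x => ((hC r hr).2.2 i x).1) z)
    (fun r hr z => hc _ C (fun x => ((hC r hr).2.2 i x).2) z)
    (fun r _ => (L (u r i)).continuous) (L (rhs (u r) (Q r) i)).continuous
  have hσr : 0 < σ - r := by linarith
  rw [integral_sum_heat₂ _ hσr, ← integral_sub (integrable_mul _ (integrable_heat hσr))
    (integrable_mul _ (integrable_heat hσr))] at h
  refine h.congr_deriv ?_
  rw [← integral_neg]
  refine integral_congr_ae (Eventually.of_forall fun z => ?_)
  simp only [rhs_eq (hs.div r hrd), hL.D_comm, map_sub, map_add, map_sum, sub_apply, add_apply,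
    sum_apply]
  ring

/-- The constant in the estimate of the nonlinear term. -/
noncomputable def nonlinC (N : ℕ) : ℝ := N * heatC N + 2 * (N * N * heatC N) + 1

lemma nonlinC_pos (N : ℕ) : 0 < nonlinC N := by
  have := heatC_pos N
  unfold nonlinC; positivity

lemma weight_nonneg {α lam μ η ℓ : ℝ} (hμ : 0 ≤ μ) (hη : 0 ≤ η) (hℓ : 0 ≤ ℓ) :
    0 ≤ weight α lam μ η ℓ := by
  unfold weight; positivity

/-- The Duhamel estimate with a weight that makes the nonlinear contribution small. -/
lemma exists_duhamel (N : ℕ) {α : ℝ} (hα : 0 ≤ α) (hα' : α < 1 / 2) {ε : ℝ} (hε : 0 < ε) :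
    ∃ lam : ℝ, 0 < lam ∧ ∀ {p A : ℝ} {T : ℝ≥0∞} {u : ℝ → Fin N → Sch N} {Q : ℝ → Sch N},
      IsSol p A T u Q → 2 ≤ p → ∀ {L : Sch N →L[ℝ] Sch N}, IsComb L → ∀ {a t μ η M B : ℝ},
      a ∈ dom T → a < t → t ≤ a + 1 → Ioc a t ⊆ good T u Q → 0 ≤ μ → 0 ≤ η → 0 ≤ M →
      ∀ i, (∀ e : ℝ, 0 < e → e ≤ 1 → |∫ z, L (u a i) z * heat (t + e - a) z| ≤ B) →
      (∀ r ∈ Ioo a t, ∀ j k, ∀ s : ℝ, 0 < s → ∫ z, |L (mulS (u r j) (u r k)) z| * heat (2 * s) z ≤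
        M * weight α lam μ η (r - a) * s ^ (-α)) →
      |L (u t i) 0| ≤ B + ε * M * weight α lam μ η (t - a) := by
  have hC := nonlinC_pos N
  obtain ⟨lam, hlam, hgrow⟩ := exists_weight_growth hα hα' (ε := ε / nonlinC N) (by positivity)
  refine ⟨lam, hlam, ?_⟩
  intro p A T u Q hs hp L hL a t μ η M B ha hat hta hgood hμ hη hM i hB hNL
  refine abs_apply_zero_le fun e he he1 => ?_
  have htd : t ∈ dom T := mem_dom_of_good (hgood ⟨hat, le_rfl⟩)
  have hcont : ContinuousOn (fun r => ∫ z, L (u r i) z * heat (t + e - r) z) (Icc a t) :=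
    (hL.continuousOn_integral_heat hp (hs.cont i) (fun r hr => hs.lp r hr i)).mono fun r hr =>
      ⟨(ordConnected_dom T).out ha htd hr, by rw [mem_Iio]; linarith [hr.2]⟩
  have h := hgrow a t μ η (nonlinC N * M) _ _ hat hta hμ hη (by positivity) hcont
    (fun r hr => hs.hasDerivAt_average hL (hgood ⟨hr.1, hr.2.le⟩)
      (show r < t + e by linarith [hr.2]) i) fun r hr => by
    have hrg := hgood ⟨hr.1, hr.2.le⟩
    have h1 : 0 < t - r := by linarith [hr.2]
    have h2 : 0 < t + e - r := by linarith
    have hw : 0 ≤ weight α lam μ η (r - a) := weight_nonneg hμ hη (by linarith [hr.1])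
    have h3 := abs_integral_nonlinear_le
      (hs.comb_pressure hL (mem_dom_of_good hrg) (pos_of_good hrg)) h2 hα
      (M := M * weight α lam μ η (r - a))
      (fun j k s hs' => hNL r hr j k s (by linarith)) i
    rw [abs_neg]
    refine h3.trans ?_
    have h4 : (t + e - r) ^ (-(1 / 2) - α) ≤ (t - r) ^ (-(1 / 2) - α) :=
      Real.rpow_le_rpow_of_nonpos h1 (by linarith) (by linarith)
    calc _ ≤ nonlinC N * (M * weight α lam μ η (r - a)) * (t - r) ^ (-(1 / 2) - α) := by
          gcongr
          unfold nonlinC; linarith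
      _ = _ := by ring
  simp only [add_sub_cancel_left] at h
  have h5 := hB e he he1
  have h6 := abs_sub_abs_le_abs_sub (∫ z, L (u t i) z * heat e z)
    (∫ z, L (u a i) z * heat (t + e - a) z)
  have h7 : ε / nonlinC N * (nonlinC N * M) = ε * M := by field_simp
  rw [h7] at h
  linarith

/-! ### Propagation of bounds -/

lemma apply_eq_trans_zero (f : Sch N) (x : Fin N → ℝ) : f x = trans x f 0 := by simp

lemma isComb_trans (x : Fin N → ℝ) : IsComb (trans x) := IsComb.one.trans_comp x

lemma IsSol.integral_trans_le (hs : IsSol p A T u Q) (hp : 1 ≤ p) {t s : ℝ} (ht : t ∈ dom T)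
    (hs0 : 0 < s) (i : Fin N) (x : Fin N → ℝ) :
    ∫ z, |trans x (u t i) z| * heat s z ≤ (1 + A) * s ^ (-((N : ℝ) / (2 * p))) := by
  refine integral_abs_heat_le_of_Lp hs0 hp ?_
  simp only [trans_apply]
  rw [integral_add_right_eq_self (fun y => |u t i y| ^ p) x]
  exact hs.lp t ht i

lemma weight_pos {α lam μ η ℓ : ℝ} (hμ : 0 ≤ μ) (hη : 0 < η) (hℓ : 0 < ℓ) :
    0 < weight α lam μ η ℓ := by
  unfold weight; positivity

/-- The velocity is controlled by any admissible weight that controls its caloric extension. -/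
lemma exists_velocity_weight (N : ℕ) {p A : ℝ} (hN : 0 < N) (hp : (N : ℝ) < p) (hp2 : 2 ≤ p)
    (hA : 0 ≤ A) :
    ∃ lam : ℝ, 0 < lam ∧ ∀ {T : ℝ≥0∞} {u : ℝ → Fin N → Sch N} {Q : ℝ → Sch N},
      IsSol p A T u Q → ∀ {a t₁ μ η S₀ : ℝ},
      a ∈ dom T → t₁ ≤ a + 1 → Ioc a t₁ ⊆ good T u Q → 0 ≤ μ → 0 < η →
      (∀ t ∈ Ioc a t₁, ∀ i x, ∀ e : ℝ, 0 < e → e ≤ 1 →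
        |∫ z, trans x (u a i) z * heat (t + e - a) z| ≤
          weight ((N : ℝ) / (2 * p)) lam μ η (t - a)) →
      (∀ t ∈ Ioc a t₁, ∀ i x, |u t i x| ≤ S₀ * weight ((N : ℝ) / (2 * p)) lam μ η (t - a)) →
      ∀ t ∈ Ioc a t₁, ∀ i x, |u t i x| ≤ 2 * weight ((N : ℝ) / (2 * p)) lam μ η (t - a) := by
  set α : ℝ := (N : ℝ) / (2 * p) with hα
  have hp0 : 0 < p := by linarith
  have hα0 : 0 ≤ α := by positivity
  have hα1 : α < 1 / 2 := by
    rw [hα, div_lt_iff₀ (by positivity)]; linarith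
  obtain ⟨lam, hlam, hduh⟩ := exists_duhamel N hα0 hα1 (ε := 1 / (2 * (1 + A))) (by positivity)
  refine ⟨lam, hlam, ?_⟩
  intro T u Q hs a t₁ μ η S₀ ha ht₁ hgood hμ hη hinit hS₀ t ht i x
  have hw : ∀ t ∈ Ioc a t₁, 0 < weight α lam μ η (t - a) := fun t ht =>
    weight_pos hμ hη (by linarith [ht.1])
  have key := le_of_contraction (ι := Ioc a t₁ × Fin N × (Fin N → ℝ)) (A := 1) (S₀ := S₀)
    (g := fun y => |u y.1 y.2.1 y.2.2| / weight α lam μ η (y.1 - a))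
    (fun y => (div_le_iff₀ (hw _ y.1.2)).2 (hS₀ _ y.1.2 _ _)) ?_ zero_le_one (⟨t, ht⟩, i, x)
  · rw [div_le_iff₀ (hw _ ht)] at key
    linarith
  · rintro S hS hg ⟨⟨t, ht⟩, i, x⟩
    have hg' : ∀ r ∈ Ioc a t₁, ∀ j z, |u r j z| ≤ S * weight α lam μ η (r - a) := fun r hr j z =>
      (div_le_iff₀ (hw r hr)).1 (hg (⟨r, hr⟩, j, z))
    rw [div_le_iff₀ (hw t ht)]
    have h := hduh hs hp2 (isComb_trans x) (M := S * (1 + A)) ha ht.1 (ht.2.trans ht₁)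
      ((Ioc_subset_Ioc_right ht.2).trans hgood) hμ hη.le (by positivity) i (hinit t ht i x) ?_
    · rw [← apply_eq_trans_zero] at h
      refine h.trans (le_of_eq ?_)
      field_simp
    · intro r hr j k s hs0
      have hr' : r ∈ Ioc a t₁ := ⟨hr.1, hr.2.le.trans ht.2⟩
      have h2s : 0 < 2 * s := by positivity
      have h1 : ∫ z, |trans x (mulS (u r j) (u r k)) z| * heat (2 * s) z ≤
          S * weight α lam μ η (r - a) * ∫ z, |trans x (u r k) z| * heat (2 * s) z := by
        rw [← integral_const_mul]
        refine integral_mono (integrable_abs_mul_heat _ h2s)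
          ((integrable_abs_mul_heat _ h2s).const_mul _) fun z => ?_
        simp only [trans_apply, mulS_apply, abs_mul]
        rw [mul_assoc]
        exact mul_le_mul_of_nonneg_right (hg' r hr' j _)
          (mul_nonneg (abs_nonneg _) (heat_pos h2s z).le)
      have h2 := hs.integral_trans_le (by linarith) (mem_dom_of_good (hgood hr')) h2s k x
      have h3 : (2 * s) ^ (-α) ≤ s ^ (-α) :=
        Real.rpow_le_rpow_of_nonpos hs0 (by linarith) (by linarith)
      have h4 := (hw r hr').le
      calc _ ≤ S * weight α lam μ η (r - a) * ((1 + A) * s ^ (-α)) := by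
            refine h1.trans ?_
            gcongr
            exact h2.trans (by gcongr)
        _ = _ := by ring

/-- Instantaneous smoothing and persistence of bounds for the velocity. -/
lemma exists_velocity_bounds (N : ℕ) {p A : ℝ} (hN : 0 < N) (hp : (N : ℝ) < p) (hp2 : 2 ≤ p)
    (hA : 0 ≤ A) :
    ∃ lam : ℝ, 0 < lam ∧ ∀ {T : ℝ≥0∞} {u : ℝ → Fin N → Sch N} {Q : ℝ → Sch N},
      IsSol p A T u Q → ∀ {a t₁ : ℝ}, a ∈ dom T → t₁ ≤ a + 1 → Ioc a t₁ ⊆ good T u Q →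
      (∀ t ∈ Ioc a t₁, ∀ i x,
        |u t i x| ≤ 2 * weight ((N : ℝ) / (2 * p)) lam 0 (1 + A) (t - a)) ∧
      ∀ n : ℝ, (∀ i x, |u a i x| ≤ n) → ∀ t ∈ Ioc a t₁, ∀ i x,
        |u t i x| ≤ 2 * (Real.exp lam * n) := by
  obtain ⟨lam, hlam, hvel⟩ := exists_velocity_weight N hN hp hp2 hA
  refine ⟨lam, hlam, ?_⟩
  intro T u Q hs a t₁ ha ht₁ hgood
  set α : ℝ := (N : ℝ) / (2 * p) with hα
  have hp0 : 0 < p := by linarith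
  have hα0 : 0 ≤ α := by positivity
  have hsmooth : ∀ t ∈ Ioc a t₁, ∀ i x, |u t i x| ≤ 2 * weight α lam 0 (1 + A) (t - a) := by
    intro t ht i x
    have hlim : Tendsto (fun a' => 2 * weight α lam 0 (1 + A) (t - a')) (𝓝[>] a)
        (𝓝 (2 * weight α lam 0 (1 + A) (t - a))) := by
      refine Tendsto.mono_left ?_ nhdsWithin_le_nhds
      have : ContinuousAt (fun a' : ℝ => (t - a') ^ (-α)) a :=
        ContinuousAt.rpow_const (by fun_prop) (Or.inl (by linarith [ht.1]))
      change ContinuousAt (fun a' => 2 * weight α lam 0 (1 + A) (t - a')) a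
      unfold weight
      fun_prop
    refine ge_of_tendsto hlim ?_
    filter_upwards [Ioo_mem_nhdsGT ht.1] with a' ha'
    have hsub : Icc a' t ⊆ good T u Q := fun r hr =>
      hgood ⟨ha'.1.trans_le hr.1, hr.2.trans ht.2⟩
    obtain ⟨C, hC0, hC⟩ := exists_bound_of_isCompact isCompact_Icc hsub
    have ha'd : a' ∈ dom T := mem_dom_of_good (hsub ⟨le_rfl, ha'.2.le⟩)
    have hexp : ∀ r ∈ Ioc a' t, (1 + A) * (r - a') ^ (-α) ≤ weight α lam 0 (1 + A) (r - a') := by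
      intro r hr
      have h0 : 0 < r - a' := by linarith [hr.1]
      unfold weight
      rw [zero_add]
      exact le_mul_of_one_le_left (by positivity) (Real.one_le_exp (by positivity))
    refine hvel hs (S₀ := C) ha'd (by linarith [ht.2, ha'.1])
      (Ioc_subset_Icc_self.trans hsub) le_rfl (by linarith) ?_ ?_ t ⟨ha'.2, le_rfl⟩ i x
    · intro r hr i x e he he1
      have h0 : 0 < r - a' := by linarith [hr.1]
      refine ((abs_integral_heat_le _ (by linarith)).trans (hs.integral_trans_le (by linarith) ha'd
        (by linarith) i x)).trans (le_trans ?_ (hexp r hr))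
      have : (r + e - a') ^ (-α) ≤ (r - a') ^ (-α) :=
        Real.rpow_le_rpow_of_nonpos h0 (by linarith) (by linarith)
      gcongr
    · intro r hr i x
      have h0 : 0 < r - a' := by linarith [hr.1]
      have h1 : 1 ≤ (r - a') ^ (-α) :=
        Real.one_le_rpow_of_pos_of_le_one_of_nonpos h0 (by linarith [hr.2, ha'.1, ht.2]) (by linarith)
      have h2 := hexp r hr
      have h3 := hC r ⟨hr.1.le, hr.2⟩ i x
      have h4 : 1 ≤ weight α lam 0 (1 + A) (r - a') := by nlinarith
      nlinarith
  refine ⟨hsmooth, ?_⟩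
  intro n hn t ht i x
  have hn0 : 0 ≤ n := (abs_nonneg _).trans (hn i x)
  have hℓ : 0 < t - a := by linarith [ht.1]
  have key : ∀ η : ℝ, 0 < η → |u t i x| ≤ 2 * weight α lam n η (t - a) := by
    intro η hη
    refine hvel hs (S₀ := 2 * (1 + A) / η) ha ht₁ hgood hn0 hη ?_ ?_ t ht i x
    · intro r hr i x e he he1
      have h0 : 0 < r - a := by linarith [hr.1]
      refine ((abs_integral_heat_le _ (by linarith)).trans
        (integral_abs_heat_le (M := n) (by linarith) fun z => by simpa using hn i _)).trans ?_
      unfold weight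
      have h1 : 1 ≤ Real.exp (lam * (r - a)) := Real.one_le_exp (by positivity)
      have h2 : 0 ≤ η * (r - a) ^ (-α) := by positivity
      nlinarith
    · intro r hr i x
      have h0 : 0 < r - a := by linarith [hr.1]
      refine (hsmooth r hr i x).trans ?_
      unfold weight
      have h2 : 0 < (r - a) ^ (-α) := by positivity
      have h3 : 0 < Real.exp (lam * (r - a)) := Real.exp_pos _
      calc 2 * (Real.exp (lam * (r - a)) * (0 + (1 + A) * (r - a) ^ (-α)))
          = 2 * (1 + A) / η * (Real.exp (lam * (r - a)) * (η * (r - a) ^ (-α))) := by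
            field_simp; ring
        _ ≤ _ := by gcongr; linarith
  have hlim : Tendsto (fun η => 2 * weight α lam n η (t - a)) (𝓝[>] 0)
      (𝓝 (2 * weight α lam n 0 (t - a))) := by
    refine Tendsto.mono_left ?_ nhdsWithin_le_nhds
    change ContinuousAt (fun η => 2 * weight α lam n η (t - a)) 0
    unfold weight
    fun_prop
  have h1 : |u t i x| ≤ 2 * weight α lam n 0 (t - a) :=
    ge_of_tendsto hlim (eventually_nhdsWithin_of_forall fun η hη => key η hη)
  refine h1.trans ?_
  unfold weight
  rw [zero_mul, add_zero]
  have : lam * (t - a) ≤ lam := mul_le_of_le_one_right hlam.le (by linarith [ht.2])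
  gcongr

/-- Persistence of bounds for combinations of translates of the velocity. -/
lemma exists_comb_bounds (N : ℕ) {p : ℝ} (hp2 : 2 ≤ p) {K₀ K₁ : ℝ} (hK₀ : 0 ≤ K₀)
    (hK₁ : 0 ≤ K₁) :
    ∃ C : ℝ, 0 < C ∧ ∀ {A : ℝ} {T : ℝ≥0∞} {u : ℝ → Fin N → Sch N} {Q : ℝ → Sch N},
      IsSol p A T u Q → ∀ {L : Sch N →L[ℝ] Sch N}, IsComb L → ∀ {a t₁ ν C₀ : ℝ}, a ∈ dom T →
      t₁ ≤ a + 1 → Ioc a t₁ ⊆ good T u Q → 0 < ν → (∀ i x, |L (u a i) x| ≤ ν) →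
      (∀ t ∈ Ioc a t₁, ∀ i x, |u t i x| ≤ C₀) →
      (∀ r ∈ Ioc a t₁, ∀ S, 0 ≤ S → (∀ i x, |L (u r i) x| ≤ S) → ∀ j k x,
        |L (mulS (u r j) (u r k)) x| ≤ K₀ * S + K₁ * ν) →
      ∀ t ∈ Ioc a t₁, ∀ i x, |L (u t i) x| ≤ C * ν := by
  obtain ⟨lam, hlam, hduh⟩ := exists_duhamel N (α := 0) le_rfl (by norm_num)
    (ε := 1 / (2 * (1 + K₀))) (by positivity)
  refine ⟨2 * (1 + K₁) * Real.exp lam, by positivity, ?_⟩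
  intro A T u Q hs L hL a t₁ ν C₀ ha ht₁ hgood hν hinit hC₀ hprod t ht i x
  have hwt : ∀ ℓ, weight 0 lam ν 0 ℓ = Real.exp (lam * ℓ) * ν := fun ℓ => by simp [weight]
  have hw : ∀ r, 0 < weight 0 lam ν 0 (r - a) := fun r => by rw [hwt]; positivity
  have hwν : ∀ r ∈ Ioc a t₁, ν ≤ weight 0 lam ν 0 (r - a) := fun r hr => by
    have h0 : 0 ≤ r - a := by linarith [hr.1]
    rw [hwt]
    exact le_mul_of_one_le_left hν.le (Real.one_le_exp (by positivity))
  obtain ⟨c, hc0, hc⟩ := hL.exists_bound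
  have hC₀0 : 0 ≤ C₀ := (abs_nonneg _).trans (hC₀ t ht i x)
  have key := le_of_contraction (ι := Ioc a t₁ × Fin N × (Fin N → ℝ)) (A := 1 + K₁)
    (S₀ := c * C₀ / ν)
    (g := fun y => |L (u y.1 y.2.1) y.2.2| / weight 0 lam ν 0 (y.1 - a))
    (fun y => div_le_div₀ (by positivity) (hc _ C₀ (fun z => hC₀ _ y.1.2 _ z) _) hν
      (hwν _ y.1.2)) ?_ (by positivity) (⟨t, ht⟩, i, x)
  · rw [div_le_iff₀ (hw _), hwt] at key
    refine key.trans ?_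
    have : lam * (t - a) ≤ lam := mul_le_of_le_one_right hlam.le (by linarith [ht.2])
    rw [← mul_assoc]
    gcongr
  · rintro S hS hg ⟨⟨t, ht⟩, i, x⟩
    have hg' : ∀ r ∈ Ioc a t₁, ∀ j z, |L (u r j) z| ≤ S * weight 0 lam ν 0 (r - a) :=
      fun r hr j z => (div_le_iff₀ (hw r)).1 (hg (⟨r, hr⟩, j, z))
    rw [div_le_iff₀ (hw t)]
    have h := hduh hs hp2 (hL.trans_comp x) (M := K₀ * S + K₁) (B := ν) ha ht.1 (ht.2.trans ht₁)
      ((Ioc_subset_Ioc_right ht.2).trans hgood) hν.le le_rfl (by positivity) i ?_ ?_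
    · rw [ContinuousLinearMap.comp_apply, ← apply_eq_trans_zero] at h
      have h1 := hwν t ht
      have h2 : 1 / (2 * (1 + K₀)) * (K₀ * S + K₁) ≤ S / 2 + K₁ := by
        rw [one_div, inv_mul_le_iff₀ (by positivity)]
        nlinarith [mul_nonneg hK₀ hS, mul_nonneg hK₀ hK₁]
      nlinarith [hw t]
    · intro e he he1
      have h0 : 0 < t + e - a := by linarith [ht.1]
      refine (abs_integral_heat_le _ h0).trans (integral_abs_heat_le h0 fun z => ?_)
      simpa using hinit i _
    · intro r hr j k s hs0
      have hr' : r ∈ Ioc a t₁ := ⟨hr.1, hr.2.le.trans ht.2⟩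
      rw [neg_zero, Real.rpow_zero, mul_one]
      refine integral_abs_heat_le (by positivity) fun z => ?_
      have h1 := hprod r hr' (S * weight 0 lam ν 0 (r - a)) (mul_nonneg hS (hw r).le)
        (hg' r hr') j k (z + x)
      have h2 := mul_le_mul_of_nonneg_left (hwν r hr') hK₁
      simp only [ContinuousLinearMap.comp_apply, trans_apply]
      linarith

/-! ### All positive times are good -/

/-- Bounds on the size and on the first and second difference quotients of a function. -/
structure DiffBound (n : ℝ) (f : Sch N) : Prop where
  zero : ∀ x, |f x| ≤ n
  one : ∀ h x, |dif h f x| ≤ n * ‖h‖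
  two : ∀ h h' x, |dif h (dif h' f) x| ≤ n * ‖h‖ * ‖h'‖

lemma DiffBound.mono {n m : ℝ} {f : Sch N} (hf : DiffBound n f) (h : n ≤ m) : DiffBound m f where
  zero x := (hf.zero x).trans h
  one k x := (hf.one k x).trans (by gcongr)
  two k k' x := (hf.two k k' x).trans (by gcongr)

lemma exists_diffBound (f : Sch N) : ∃ n, DiffBound n f := by
  obtain ⟨C₀, h₀, hC₀⟩ := exists_bound f
  choose C₁ h₁ hC₁ using fun j => exists_bound (D j f)
  choose C₂ h₂ hC₂ using fun j k => exists_bound (D j (D k f))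
  have b₁ : ∀ j x, |D j f x| ≤ ∑ j, C₁ j := fun j x =>
    (hC₁ j x).trans (Finset.single_le_sum (fun j _ => h₁ j) (Finset.mem_univ j))
  have b₂ : ∀ j k x, |D j (D k f) x| ≤ ∑ j, ∑ k, C₂ j k := fun j k x =>
    ((hC₂ j k x).trans (Finset.single_le_sum (fun k _ => h₂ j k) (Finset.mem_univ k))).trans
      (Finset.single_le_sum (f := fun j => ∑ k, C₂ j k)
        (fun j _ => Finset.sum_nonneg fun k _ => h₂ j k) (Finset.mem_univ j))
  have e₁ : 0 ≤ ∑ j, C₁ j := Finset.sum_nonneg fun j _ => h₁ j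
  have e₂ : 0 ≤ ∑ j, ∑ k, C₂ j k := Finset.sum_nonneg fun j _ => Finset.sum_nonneg fun k _ => h₂ j k
  have m₁ : 0 ≤ N * ∑ j, C₁ j := by positivity
  have m₂ : 0 ≤ N * (N * ∑ j, ∑ k, C₂ j k) := by positivity
  refine ⟨C₀ + N * (∑ j, C₁ j) + N * (N * ∑ j, ∑ k, C₂ j k), fun x => ?_, fun h x => ?_,
    fun h h' x => ?_⟩
  · linarith [hC₀ x]
  · refine (abs_dif_le b₁ h x).trans ?_
    gcongr
    linarith
  · refine (abs_dif_dif_le b₂ h h' x).trans ?_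
    gcongr
    linarith

lemma exists_common_diffBound (w : Fin N → Sch N) : ∃ n, 1 ≤ n ∧ ∀ i, DiffBound n (w i) := by
  choose n hn using fun i => exists_diffBound (w i)
  have h0 : 0 ≤ ∑ i, |n i| := Finset.sum_nonneg fun i _ => abs_nonneg (n i)
  refine ⟨1 + ∑ i, |n i|, by linarith, fun i => (hn i).mono ?_⟩
  have h1 : |n i| ≤ ∑ i, |n i| :=
    Finset.single_le_sum (fun i _ => abs_nonneg (n i)) (Finset.mem_univ i)
  linarith [le_abs_self (n i)]

lemma abs_dif_mulS_le {f g : Sch N} {M S : ℝ} {h : Fin N → ℝ} (hf : ∀ x, |f x| ≤ M)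
    (hg : ∀ x, |g x| ≤ M) (hf₁ : ∀ x, |dif h f x| ≤ S) (hg₁ : ∀ x, |dif h g x| ≤ S)
    (x : Fin N → ℝ) : |dif h (mulS f g) x| ≤ 2 * M * S := by
  have e : dif h (mulS f g) x = dif h f x * g (x + h) + f x * dif h g x := by
    simp; ring
  have hM := (abs_nonneg _).trans (hf x)
  have hS := (abs_nonneg _).trans (hf₁ x)
  calc _ ≤ |dif h f x| * |g (x + h)| + |f x| * |dif h g x| := by
        rw [e, ← abs_mul, ← abs_mul]; exact abs_add_le _ _
    _ ≤ S * M + M * S := by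
        gcongr
        exacts [hf₁ x, hg _, hf x, hg₁ x]
    _ = _ := by ring

lemma abs_dif_dif_mulS_le {f g : Sch N} {M B B' S : ℝ} {h h' : Fin N → ℝ} (hf : ∀ x, |f x| ≤ M)
    (hg : ∀ x, |g x| ≤ M) (hf₁ : ∀ x, |dif h f x| ≤ B) (hg₁ : ∀ x, |dif h g x| ≤ B)
    (hf₁' : ∀ x, |dif h' f x| ≤ B') (hg₁' : ∀ x, |dif h' g x| ≤ B')
    (hf₂ : ∀ x, |dif h (dif h' f) x| ≤ S) (hg₂ : ∀ x, |dif h (dif h' g) x| ≤ S)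
    (x : Fin N → ℝ) : |dif h (dif h' (mulS f g)) x| ≤ 2 * M * S + 2 * (B * B') := by
  have e : dif h (dif h' (mulS f g)) x = dif h (dif h' f) x * g (x + h + h')
      + dif h f x * dif h' g (x + h) + dif h' f x * dif h g (x + h')
      + f x * dif h (dif h' g) x := by
    simp only [dif_apply, mulS_apply, add_right_comm x h' h]; ring
  have hM := (abs_nonneg _).trans (hf x)
  have hB := (abs_nonneg _).trans (hf₁ x)
  have hB' := (abs_nonneg _).trans (hf₁' x)
  have hS := (abs_nonneg _).trans (hf₂ x)
  calc _ ≤ |dif h (dif h' f) x| * |g (x + h + h')| + |dif h f x| * |dif h' g (x + h)|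
        + |dif h' f x| * |dif h g (x + h')| + |f x| * |dif h (dif h' g) x| := by
        rw [e]
        simp only [← abs_mul]
        exact (abs_add_le _ _).trans (by gcongr; exact abs_add_three _ _ _)
    _ ≤ S * M + B * B' + B' * B + M * S := by
        gcongr
        exacts [hf₂ x, hg _, hf₁ x, hg₁' _, hf₁' x, hg₁ _, hf x, hg₂ x]
    _ = _ := by ring

lemma dif_zero (f : Sch N) : dif 0 f = 0 := by ext x; simp

/-- Bounds on difference quotients propagate across intervals of good times. -/
lemma exists_diffBound_propagation (N : ℕ) {p A : ℝ} (hN : 0 < N) (hp : (N : ℝ) < p)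
    (hp2 : 2 ≤ p) (hA : 0 ≤ A) {n : ℝ} (hn : 1 ≤ n) :
    ∃ m : ℝ, ∀ {T : ℝ≥0∞} {u : ℝ → Fin N → Sch N} {Q : ℝ → Sch N}, IsSol p A T u Q →
      ∀ {a t₁ : ℝ}, a ∈ dom T → t₁ ≤ a + 1 → Ioc a t₁ ⊆ good T u Q →
      (∀ i, DiffBound n (u a i)) → ∀ t ∈ Ioc a t₁, ∀ i, DiffBound m (u t i) := by
  obtain ⟨lam, -, hlam⟩ := exists_velocity_bounds N hN hp hp2 hA
  set M : ℝ := 2 * (Real.exp lam * n) with hM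
  have hM0 : 0 ≤ M := by positivity
  obtain ⟨C₁, hC₁0, hC₁⟩ := exists_comb_bounds N hp2 (K₀ := 2 * M) (K₁ := 0) (by positivity) le_rfl
  obtain ⟨C₂, hC₂0, hC₂⟩ := exists_comb_bounds N hp2 (K₀ := 2 * M) (K₁ := 2 * (C₁ * n) ^ 2)
    (by positivity) (by positivity)
  refine ⟨M + C₁ * n + C₂ * n, fun {T u Q} hs {a t₁} ha hat hgood hbd => ?_⟩
  have h₀ : ∀ t ∈ Ioc a t₁, ∀ i x, |u t i x| ≤ M :=
    (hlam hs ha hat hgood).2 n fun i x => (hbd i).zero x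
  have h₁ : ∀ h, ∀ t ∈ Ioc a t₁, ∀ i x, |dif h (u t i) x| ≤ C₁ * n * ‖h‖ := by
    intro h
    rcases eq_or_ne h 0 with rfl | hh
    · simp [dif_zero]
    · intro t ht i x
      have := hC₁ hs (IsComb.one.dif_comp h) (ν := n * ‖h‖) (C₀ := M) ha hat hgood
        (by positivity) (fun i x => (hbd i).one h x) h₀
        (fun r hr S _ hS j k x => by
          have := abs_dif_mulS_le (h₀ r hr j) (h₀ r hr k) (hS j) (hS k) x
          simpa using this) t ht i x
      simpa [mul_assoc] using this
  have h₂ : ∀ h h', ∀ t ∈ Ioc a t₁, ∀ i x,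
      |dif h (dif h' (u t i)) x| ≤ C₂ * n * ‖h‖ * ‖h'‖ := by
    intro h h'
    rcases eq_or_ne h 0 with rfl | hh
    · simp [dif_zero]
    rcases eq_or_ne h' 0 with rfl | hh'
    · simp [dif_zero]
    intro t ht i x
    have := hC₂ hs ((IsComb.one.dif_comp h').dif_comp h) (ν := n * ‖h‖ * ‖h'‖) (C₀ := M) ha hat
      hgood (by positivity) (fun i x => (hbd i).two h h' x) h₀
      (fun r hr S _ hS j k x => by
        have := abs_dif_dif_mulS_le (h₀ r hr j) (h₀ r hr k) (h₁ h r hr j) (h₁ h r hr k)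
          (h₁ h' r hr j) (h₁ h' r hr k) (hS j) (hS k) x
        refine this.trans ?_
        have e : C₁ * n * ‖h‖ * (C₁ * n * ‖h'‖) = (C₁ * n) ^ 2 * (1 * ‖h‖ * ‖h'‖) := by ring
        rw [e, mul_assoc 2 ((C₁ * n) ^ 2)]
        gcongr) t ht i x
    calc _ ≤ _ := this
      _ = _ := by ring
  have i₁ : 0 ≤ C₁ * n := by positivity
  have i₂ : 0 ≤ C₂ * n := by positivity
  intro t ht i
  refine ⟨fun x => (h₀ t ht i x).trans (by linarith), fun h x => (h₁ h t ht i x).trans ?_,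
    fun h h' x => (h₂ h h' t ht i x).trans ?_⟩
  · gcongr; linarith
  · gcongr; linarith

/-- Bounds on difference quotients of the velocity bound its time derivative. -/
lemma IsSol.abs_rhs_le (hs : IsSol p A T u Q) {t n : ℝ} (ht : t ∈ dom T) (h0 : 0 < t)
    (hn : 0 ≤ n) (hu : ∀ i, DiffBound n (u t i)) (i : Fin N) (x : Fin N → ℝ) :
    |rhs (u t) (Q t) i x| ≤ N * n + N * (n * n) + 4 * (N * N * (heatC N * (4 * (n * n)))) := by
  have d₀ : ∀ i x, |u t i x| ≤ n := fun i => (hu i).zero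
  have d₁ : ∀ i j x, |D j (u t i) x| ≤ n := fun i j x => abs_D_le_of_dif (hu i).one j x
  have d₂ : ∀ i j k x, |D j (D k (u t i)) x| ≤ n := fun i j k x =>
    abs_D_D_le_of_dif (hu i).two j k x
  have hmul : ∀ {a b : ℝ}, |a| ≤ n → |b| ≤ n → |a * b| ≤ n * n := fun ha hb => by
    rw [abs_mul]; gcongr
  have hθ : |D i (Q t) x| ≤ 4 * (N * N * (heatC N * (4 * (n * n)))) := by
    have := abs_pressure_gradient_zero_le (hs.comb_pressure (isComb_trans x) ht h0)
      (M := 4 * (n * n)) (fun j k y => ?_) (fun j k y => ?_) i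
    · rwa [D_trans, ← apply_eq_trans_zero] at this
    · rw [trans_apply, mulS_apply]
      linarith [hmul (d₀ j (y + x)) (d₀ k (y + x)), mul_nonneg hn hn]
    · simp only [D_trans, D_mul, map_add, trans_apply, add_apply, mulS_apply]
      set z := y + x
      have b₁ := hmul (d₂ j j k z) (d₀ k z)
      have b₂ := hmul (d₁ j k z) (d₁ k j z)
      have b₃ := hmul (d₁ j j z) (d₁ k k z)
      have b₄ := hmul (d₀ j z) (d₂ k j k z)
      rw [abs_le] at *
      constructor <;> linarith
  have hsum : ∀ {f : Fin N → ℝ} {c : ℝ}, (∀ j, |f j| ≤ c) → |∑ j, f j| ≤ N * c := by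
    intro f c hf
    refine (Finset.abs_sum_le_sum_abs _ _).trans ((Finset.sum_le_sum fun j _ => hf j).trans ?_)
    simp
  have e : rhs (u t) (Q t) i x = ∑ j, D j (D j (u t i)) x - ∑ j, u t j x * D j (u t i) x
      - D i (Q t) x := by
    simp [rhs, sum_apply, sub_apply]
  rw [e]
  refine (abs_sub _ _).trans (add_le_add ((abs_sub _ _).trans (add_le_add ?_ ?_)) hθ)
  · exact hsum fun j => d₂ i j j x
  · exact hsum fun j => hmul (d₀ j x) (d₁ i j x)

lemma isOpen_dom_inter_Ioi (T : ℝ≥0∞) : IsOpen (dom T ∩ Ioi 0) :=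
  isOpen_iff_mem_nhds.2 fun _ ht => inter_mem (dom_mem_nhds ht.1 ht.2) (Ioi_mem_nhds ht.2)

lemma IsSol.isClosed_diffBound (hs : IsSol p A T u Q) {E : Set ℝ} (hE : E ⊆ dom T) (n : ℝ) :
    IsClosed {t : E | ∀ i, DiffBound n (u t i)} := by
  have hc : ∀ {L : Sch N →L[ℝ] Sch N}, IsComb L → ∀ i x,
      Continuous fun t : E => |L (u t i) x| := fun hL i x =>
    (((hL.continuousOn (fun x => hs.cont i x) x).mono hE).domRestrict).abs
  have e : {t : E | ∀ i, DiffBound n (u t i)} = {t : E | ∀ i,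
      (∀ x, |u t i x| ≤ n) ∧ (∀ h x, |dif h (u t i) x| ≤ n * ‖h‖) ∧
      ∀ h h' x, |dif h (dif h' (u t i)) x| ≤ n * ‖h‖ * ‖h'‖} := by
    ext t
    exact forall_congr' fun i => ⟨fun h => ⟨h.zero, h.one, h.two⟩, fun h => ⟨h.1, h.2.1, h.2.2⟩⟩
  rw [e]
  simp only [ofPred_forall, ofPred_and]
  refine isClosed_iInter fun i => IsClosed.inter ?_ (IsClosed.inter ?_ ?_)
  · exact isClosed_iInter fun x => isClosed_le (hc IsComb.one i x) continuous_const
  · exact isClosed_iInter fun h => isClosed_iInter fun x =>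
      isClosed_le (hc (IsComb.one.dif_comp h) i x) continuous_const
  · exact isClosed_iInter fun h => isClosed_iInter fun h' => isClosed_iInter fun x =>
      isClosed_le (hc ((IsComb.one.dif_comp h').dif_comp h) i x) continuous_const

/-- Every positive time is good: otherwise, by the Baire category theorem, the bad times contain a relatively
open piece on which the difference quotients are uniformly bounded, and the bounds propagate from
there to a full neighbourhood. -/
theorem IsSol.dom_subset_good (hs : IsSol p A T u Q) (hN : 0 < N) (hp : (N : ℝ) < p)
    (hp2 : 2 ≤ p) (hA : 0 ≤ A) : dom T ∩ Ioi 0 ⊆ good T u Q := by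
  by_contra hcon
  set E : Set ℝ := (dom T ∩ Ioi 0) \ good T u Q with hE
  have hEne : E.Nonempty := by
    obtain ⟨t, ht, hg⟩ := not_subset.1 hcon
    exact ⟨t, ht, hg⟩
  have hEd : E ⊆ dom T := fun t ht => ht.1.1
  have hlc : IsLocallyClosed E :=
    (isOpen_dom_inter_Ioi T).isLocallyClosed.inter isOpen_good.isClosed_compl.isLocallyClosed
  have := hlc.locallyCompactSpace
  have : Nonempty E := hEne.to_subtype
  obtain ⟨k, ⟨t₁, hE₁⟩, ht₁⟩ := nonempty_interior_of_iUnion_of_closed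
    (f := fun k : ℕ => {t : E | ∀ i, DiffBound k (u t i)}) (fun k => hs.isClosed_diffBound hEd k) (by
      refine eq_univ_of_forall fun t => mem_iUnion.2 ?_
      obtain ⟨n, -, hn⟩ := exists_common_diffBound (u t)
      obtain ⟨k, hk⟩ := exists_nat_ge n
      exact ⟨k, fun i => (hn i).mono hk⟩)
  obtain ⟨V, hV, hVE⟩ := mem_nhds_subtype E ⟨t₁, hE₁⟩ _ |>.1 (mem_interior_iff_mem_nhds.1 ht₁)
  obtain ⟨ε, hε, hball⟩ := Metric.mem_nhds_iff.1
    (inter_mem hV ((isOpen_dom_inter_Ioi T).mem_nhds hE₁.1))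
  set δ : ℝ := min (ε / 2) (1 / 2) with hδ
  have hδ0 : 0 < δ := by positivity
  have hδε : δ < ε := (min_le_left _ _).trans_lt (by linarith)
  have hδ2 : δ ≤ 1 / 2 := min_le_right _ _
  have hmem : ∀ t ∈ Icc (t₁ - δ) (t₁ + δ), t ∈ V ∩ (dom T ∩ Ioi 0) := fun t ht =>
    hball (by rw [Metric.mem_ball, Real.dist_eq, abs_lt]; constructor <;> linarith [ht.1, ht.2])
  obtain ⟨n₀, hn₀, hc⟩ := exists_common_diffBound (u (t₁ - δ))
  set n : ℝ := max n₀ k with hn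
  have hn1 : 1 ≤ n := hn₀.trans (le_max_left _ _)
  obtain ⟨m, hm⟩ := exists_diffBound_propagation N hN hp hp2 hA hn1
  have hcpt : ∀ t, t ∈ Icc (t₁ - δ) (t₁ + δ) → IsClosed (Icc (t₁ - δ) t ∩ E) := by
    intro t ht
    have : Icc (t₁ - δ) t ∩ E = Icc (t₁ - δ) t ∩ (good T u Q)ᶜ := by
      ext r
      refine and_congr_right fun hr => ⟨fun h => h.2, fun h => ⟨?_, h⟩⟩
      exact (hmem r ⟨hr.1, hr.2.trans ht.2⟩).2
    rw [this]
    exact isClosed_Icc.inter isOpen_good.isClosed_compl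
  have key : ∀ t ∈ Icc (t₁ - δ) (t₁ + δ), ∀ i, DiffBound (max n m) (u t i) := by
    intro t ht
    set B : Set ℝ := insert (t₁ - δ) (Icc (t₁ - δ) t ∩ E) with hB
    have hBc : IsClosed B := by
      rw [hB, insert_eq]; exact isClosed_singleton.union (hcpt t ht)
    have hBb : ∀ r ∈ B, r ∈ Icc (t₁ - δ) t := by
      rintro r (rfl | hr)
      exacts [⟨le_rfl, ht.1⟩, hr.1]
    have hBbd : BddAbove B := ⟨t, fun r hr => (hBb r hr).2⟩
    have haB : sSup B ∈ B := hBc.csSup_mem ⟨_, mem_insert _ _⟩ hBbd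
    set a := sSup B with ha
    have hat := hBb a haB
    have hna : ∀ i, DiffBound n (u a i) := by
      rcases haB with h | h
      · rw [h]; exact fun i => (hc i).mono (le_max_left _ _)
      · have := hVE (a := ⟨a, h.2⟩) (hmem a ⟨h.1.1, h.1.2.trans ht.2⟩).1
        exact fun i => (this i).mono (le_max_right _ _)
    rcases hat.2.eq_or_lt with h | h
    · rw [← h]; exact fun i => (hna i).mono (le_max_left _ _)
    · intro i
      refine (hm hs (t₁ := t) (hmem a ⟨hat.1, hat.2.trans ht.2⟩).2.1 (by linarith [hat.1, ht.2]) ?_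
        hna t ⟨h, le_rfl⟩ i).mono (le_max_right _ _)
      intro r hr
      by_contra hrg
      have hrI : r ∈ Icc (t₁ - δ) t := ⟨hat.1.trans hr.1.le, hr.2⟩
      have : r ∈ B := Or.inr ⟨hrI, (hmem r ⟨hrI.1, hrI.2.trans ht.2⟩).2, hrg⟩
      exact absurd (le_csSup hBbd this) (not_le.2 hr.1)
  have hnm : 0 ≤ max n m := le_max_of_le_left (by linarith)
  refine hE₁.2 ⟨δ, hδ0, max (max n m) (N * max n m + N * (max n m * max n m)
    + 4 * (N * N * (heatC N * (4 * (max n m * max n m))))), fun r hr => ?_⟩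
  rw [Metric.mem_ball, Real.dist_eq, abs_lt] at hr
  have hrI : r ∈ Icc (t₁ - δ) (t₁ + δ) := ⟨by linarith, by linarith⟩
  have hrd := (hmem r hrI).2
  exact ⟨hrd.1, hrd.2, fun i x => ⟨((key r hrI i).zero x).trans (le_max_left _ _),
    (hs.abs_rhs_le hrd.1 hrd.2 hnm (key r hrI) i x).trans (le_max_right _ _)⟩⟩

/-! ### The uniform bound -/

theorem IsSol.exists_uniform_bound (hs : IsSol p A T u Q) (hN : 0 < N) (hp : (N : ℝ) < p)
    (hp2 : 2 ≤ p) (hA : 0 ≤ A) : ∃ M, ∀ t ∈ dom T, ∀ i x, |u t i x| ≤ M := by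
  obtain ⟨lam, -, hlam⟩ := exists_velocity_bounds N hN hp hp2 hA
  have hgood := hs.dom_subset_good hN hp hp2 hA
  obtain ⟨n, -, hn⟩ := exists_common_diffBound (u 0)
  refine ⟨max n (max (2 * (Real.exp lam * n)) (2 * (Real.exp lam * (1 + A)))),
    fun t ht i x => ?_⟩
  have h0 : (0 : ℝ) ∈ dom T := ⟨le_rfl, by simpa using bot_le.trans_lt ht.2⟩
  have hsub : ∀ a, 0 ≤ a → Ioc a t ⊆ good T u Q := fun a ha r hr =>
    hgood ⟨(ordConnected_dom T).out h0 ht ⟨ha.trans hr.1.le, hr.2⟩, ha.trans_lt hr.1⟩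
  rcases ht.1.eq_or_lt with rfl | hpos
  · exact ((hn i).zero x).trans (le_max_left _ _)
  rcases le_or_gt t 1 with h1 | h1
  · exact ((hlam hs h0 (by linarith) (hsub 0 le_rfl)).2 n (fun i x => (hn i).zero x) t
      ⟨hpos, le_rfl⟩ i x).trans ((le_max_left _ _).trans (le_max_right _ _))
  · have ha : t - 1 ∈ dom T := (ordConnected_dom T).out h0 ht ⟨by linarith, by linarith⟩
    have := (hlam hs ha (by linarith) (hsub (t - 1) (by linarith))).1 t ⟨by linarith, le_rfl⟩ i x
    refine this.trans (le_of_eq_of_le ?_ ((le_max_right _ _).trans (le_max_right _ _)))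
    simp [weight]

lemma integrable_sqrt_rpow (w : Fin N → Sch N) (hp : 0 < p) :
    Integrable fun x => Real.sqrt (∑ i, w i x ^ 2) ^ p := by
  have hdom : Integrable fun x => (N : ℝ) ^ p * ∑ i, |w i x| ^ p :=
    (integrable_finsetSum _ fun i _ => integrable_abs_rpow (w i) hp).const_mul _
  refine hdom.mono' ?_ (Eventually.of_forall fun x => ?_)
  · have : Continuous fun x => Real.sqrt (∑ i, w i x ^ 2) ^ p :=
      (Real.continuous_sqrt.comp (continuous_finsetSum _ fun i _ =>
        (w i).continuous.pow 2)).rpow_const fun _ => Or.inr hp.le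
    exact this.aestronglyMeasurable
  · rw [Real.norm_of_nonneg (by positivity)]
    rcases isEmpty_or_nonempty (Fin N) with hN | hN
    · simp [Real.zero_rpow hp.ne']
    obtain ⟨k, -, hk⟩ := Finset.exists_max_image Finset.univ (fun i => |w i x|)
      Finset.univ_nonempty
    have h1 : Real.sqrt (∑ i, w i x ^ 2) ≤ N * |w k x| := by
      refine Real.sqrt_le_iff.2 ⟨by positivity, ?_⟩
      have hN1 : (1 : ℝ) ≤ N := by exact_mod_cast Fin.pos k
      calc ∑ i, w i x ^ 2 ≤ ∑ _i : Fin N, |w k x| ^ 2 := Finset.sum_le_sum fun i hi => by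
            exact sq_le_sq.2 (by rw [abs_abs]; exact hk i hi)
        _ = N * |w k x| ^ 2 := by simp
        _ ≤ N ^ 2 * |w k x| ^ 2 := by gcongr; nlinarith
        _ = _ := by ring
    calc _ ≤ (N * |w k x|) ^ p := by gcongr
      _ = N ^ p * |w k x| ^ p := Real.mul_rpow (by positivity) (by positivity)
      _ ≤ _ := by
        gcongr
        exact Finset.single_le_sum (f := fun i => |w i x| ^ p) (fun i _ => by positivity)
          (Finset.mem_univ k)

lemma integral_abs_rpow_le (w : Fin N → Sch N) (hp : 0 < p) {K : ℝ}
    (hK : (∫ x, Real.sqrt (∑ i, w i x ^ 2) ^ p) ^ (1 / p) ≤ K) (i : Fin N) :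
    ∫ x, |w i x| ^ p ≤ |K| ^ p := by
  have h0 : 0 ≤ ∫ x, Real.sqrt (∑ i, w i x ^ 2) ^ p := integral_nonneg fun x => by positivity
  calc ∫ x, |w i x| ^ p ≤ ∫ x, Real.sqrt (∑ i, w i x ^ 2) ^ p := by
        refine integral_mono (integrable_abs_rpow (w i) hp) (integrable_sqrt_rpow w hp) fun x => ?_
        have : |w i x| ≤ Real.sqrt (∑ i, w i x ^ 2) := by
          refine Real.abs_le_sqrt ?_
          exact Finset.single_le_sum (f := fun i => w i x ^ 2) (fun i _ => by positivity)
            (Finset.mem_univ i)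
        show |w i x| ^ p ≤ Real.sqrt (∑ i, w i x ^ 2) ^ p
        gcongr
    _ = ((∫ x, Real.sqrt (∑ i, w i x ^ 2) ^ p) ^ (1 / p)) ^ p := by
        rw [← Real.rpow_mul h0, one_div_mul_cancel hp.ne', Real.rpow_one]
    _ ≤ |K| ^ p := by
        gcongr
        exact hK.trans (le_abs_self K)

/-- A classical solution with Schwartz time slices, bounded in `L^p`, as a family of Schwartz
functions. -/
lemma exists_isSol (hp : 0 < p)
    {v : (Fin N → ℝ) → ℝ → Fin N → ℝ} {q : (Fin N → ℝ) → ℝ → ℝ} {K : ℝ}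
    (hSv : ∀ t ∈ dom T, ∀ i, IsSchwartz (fun x => v x t i))
    (hSq : ∀ t ∈ dom T, IsSchwartz (fun x => q x t))
    (htc : ∀ x i, ContinuousOn (fun s => v x s i) (dom T))
    (htd : ∀ x i, ∀ t ∈ dom T, 0 < t → DifferentiableAt ℝ (fun s => v x s i) t)
    (hdiv : ∀ x, ∀ t ∈ dom T, ∑ k, pd k (fun y => v y t k) x = 0)
    (hPDE : ∀ x i, ∀ t ∈ dom T, 0 < t →
      deriv (fun s => v x s i) t + ∑ j, v x t j * pd j (fun y => v y t i) x =
        -(pd i (fun y => q y t) x) + ∑ j, pd j (fun y => pd j (fun z => v z t i) y) x)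
    (hLp : ∀ t ∈ dom T, (∫ x : Fin N → ℝ, Real.sqrt (∑ i, (v x t i) ^ 2) ^ p) ^ (1 / p) ≤ K) :
    ∃ (u : ℝ → Fin N → Sch N) (Q : ℝ → Sch N), IsSol p (|K| ^ p) T u Q ∧
      ∀ t ∈ dom T, ∀ i x, u t i x = v x t i := by
  choose! u hu using hSv
  choose! Q hQ using hSq
  replace hu : ∀ t ∈ dom T, ∀ i x, u t i x = v x t i := hu
  have hu' : ∀ t ∈ dom T, ∀ i, (fun x => v x t i) = u t i := fun t ht i =>
    funext fun x => (hu t ht i x).symm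
  have hQ' : ∀ t ∈ dom T, (fun x => q x t) = Q t := fun t ht => funext fun x => (hQ t ht x).symm
  refine ⟨u, Q, ⟨fun i x => ?_, fun t ht h0 i x => ?_, fun t ht => ?_, fun t ht i => ?_⟩, hu⟩
  · exact (htc x i).congr fun t ht => hu t ht i x
  · have h1 : HasDerivAt (fun s => v x s i) (deriv (fun s => v x s i) t) t :=
      (htd x i t ht h0).hasDerivAt
    refine (h1.congr_of_eventuallyEq ?_).congr_deriv ?_
    · filter_upwards [dom_mem_nhds ht h0] with r hr using hu r hr i x
    · have h2 := hPDE x i t ht h0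
      simp only [hu' t ht, hQ' t ht, ← hu t ht _ x, ← D_apply] at h2
      simp only [rhs, sub_apply, sum_apply, mulS_apply]
      linarith
  · ext x
    have h2 := hdiv x t ht
    simp only [hu' t ht, ← D_apply] at h2
    simpa [sum_apply] using h2
  · refine integral_abs_rpow_le (u t) hp ?_ i
    simpa only [hu t ht] using hLp t ht

end NavierStokes

/-- **`L^p` regularity criterion for the Navier–Stokes equations (`p > N > 2`).**
If a classical Schwartz solution `(v, q)` on `ℝ^N × [0,T)` (`0 < T ≤ ∞`) of the
Navier–Stokes equations is uniformly bounded in `L^p` with `p > N`, then `v` does not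
blow up and is uniformly bounded in `L^∞`. -/
theorem navier_stokes_Lp_regularity
    (N : ℕ) (hN : 2 < N) (p : ℝ) (hp : (N:ℝ) < p)
    (T : ℝ≥0∞) (hT : 0 < T)
    (v : (Fin N → ℝ) → ℝ → Fin N → ℝ) (q : (Fin N → ℝ) → ℝ → ℝ)
    (hSv : ∀ t : ℝ, 0 ≤ t → ENNReal.ofReal t < T → ∀ i, IsSchwartz (fun x => v x t i))
    (hSq : ∀ t : ℝ, 0 ≤ t → ENNReal.ofReal t < T → IsSchwartz (fun x => q x t))
    (htc : ∀ x i, ContinuousOn (fun s => v x s i) {t : ℝ | 0 ≤ t ∧ ENNReal.ofReal t < T})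
    (htd : ∀ x i, ∀ t : ℝ, 0 < t → ENNReal.ofReal t < T →
      DifferentiableAt ℝ (fun s => v x s i) t)
    (hdiv : ∀ x, ∀ t : ℝ, 0 ≤ t → ENNReal.ofReal t < T →
      ∑ k, pd k (fun y => v y t k) x = 0)
    (hPDE : ∀ x i, ∀ t : ℝ, 0 < t → ENNReal.ofReal t < T →
      deriv (fun s => v x s i) t + ∑ j, v x t j * pd j (fun y => v y t i) x =
        -(pd i (fun y => q y t) x)
          + ∑ j, pd j (fun y => pd j (fun z => v z t i) y) x)
    (hLp : ∃ K : ℝ, ∀ t : ℝ, 0 ≤ t → ENNReal.ofReal t < T →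
      (∫ x : Fin N → ℝ, Real.sqrt (∑ i, (v x t i) ^ 2) ^ p) ^ (1 / p) ≤ K) :
    ∃ M : ℝ, ∀ x, ∀ t : ℝ, 0 ≤ t → ENNReal.ofReal t < T →
      Real.sqrt (∑ i, (v x t i) ^ 2) ≤ M := by
  obtain ⟨K, hK⟩ := hLp
  have hN' : (2 : ℝ) < N := by exact_mod_cast hN
  obtain ⟨u, Q, hs, hu⟩ := NavierStokes.exists_isSol (T := T) (by linarith : 0 < p)
    (fun t ht => hSv t ht.1 ht.2) (fun t ht => hSq t ht.1 ht.2) htc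
    (fun x i t ht h0 => htd x i t h0 ht.2) (fun x t ht => hdiv x t ht.1 ht.2)
    (fun x i t ht h0 => hPDE x i t h0 ht.2) (fun t ht => hK t ht.1 ht.2)
  obtain ⟨M, hM⟩ := hs.exists_uniform_bound (by omega) hp (by linarith) (by positivity)
  refine ⟨Real.sqrt (N * M ^ 2), fun x t h0 ht => Real.sqrt_le_sqrt ?_⟩
  calc ∑ i, v x t i ^ 2 ≤ ∑ _i : Fin N, M ^ 2 := Finset.sum_le_sum fun i _ => by
        have h := hM t ⟨h0, ht⟩ i x
        rw [hu t ⟨h0, ht⟩] at h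
        exact sq_le_sq.2 (h.trans (le_abs_self M))
    _ = N * M ^ 2 := by simp
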